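/- Let G = Z/2 act diagonally (antipodally on each factor) on S_{n̄} = S^{n₁}×···×S^{n_r}, where all nᵢ ≥ 1, and let k be the number of indices i with nᵢ even. Then, in the reduced convention, TC_G(S_{n̄}) = ℓ(n̄) + k, where ℓ(n̄) = r is the number of factors; equivalently, since TC_G(Sⁿ) = 1 or 2 according as n is odd or even, TC_G(S_{n̄}) = Σᵢ TC_G(S^{nᵢ}). -/

import Mathlib

noncomputable section

open unitInterval Set

/-- The double evaluation map `X^{[0,1]} → X × X`, sending a path `γ : [0,1] → X`
to the pair of its endpoints `(γ(0), γ(1))`. -/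
def pathEval (X : Type*) [TopologicalSpace X] (γ : C(I, X)) : X × X := (γ 0, γ 1)

/-- `X × X` admits a cover by `k + 1` open sets on each of which the double evaluation
map `X^{[0,1]} → X × X` admits a continuous section. -/
def TCCover (X : Type*) [TopologicalSpace X] (k : ℕ) : Prop :=
  ∃ U : Fin (k + 1) → Set (X × X),
    (∀ i, IsOpen (U i)) ∧ (⋃ i, U i) = Set.univ ∧
    ∀ i, ∃ s : C(U i, C(I, X)), ∀ u : U i, pathEval X (s u) = (u : X × X)

/-- Farber's (reduced) topological complexity, as an element of `ℕ∞`. -/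
def topComplexity (X : Type*) [TopologicalSpace X] : ℕ∞ :=
  sInf {c : ℕ∞ | ∃ k : ℕ, TCCover X k ∧ c = k}

/-- `X × X` admits a cover by `k + 1` `G`-invariant open sets (for the diagonal `G`-action)
on each of which the double evaluation map admits a continuous `G`-equivariant section. -/
def EqTCCover (G X : Type*) [Group G] [TopologicalSpace X] [MulAction G X] (k : ℕ) : Prop :=
  ∃ U : Fin (k + 1) → Set (X × X),
    (∀ i, IsOpen (U i)) ∧ (⋃ i, U i) = Set.univ ∧
    (∀ i (g : G) p, p ∈ U i → g • p ∈ U i) ∧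
    ∀ i, ∃ s : C(U i, C(I, X)),
      (∀ u : U i, pathEval X (s u) = (u : X × X)) ∧
      ∀ (g : G) (u : U i) (hg : g • (u : X × X) ∈ U i) (t : I),
        (s ⟨g • (u : X × X), hg⟩) t = g • (s u) t

/-- The (reduced) equivariant topological complexity `TC_G(X)` of Colman–Grant,
as an element of `ℕ∞`. -/
def eqTC (G X : Type*) [Group G] [TopologicalSpace X] [MulAction G X] : ℕ∞ :=
  sInf {c : ℕ∞ | ∃ k : ℕ, EqTCCover G X k ∧ c = k}

/-- The antipodal `ℤ/2`-action (modelled on the group `ℤˣ = {±1}`) on the unit sphere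
`Sⁿ ⊆ ℝ^{n+1}`: the generator acts by the antipodal map `x ↦ -x`. -/
instance sphereAntipodalSMul (n : ℕ) :
    SMul ℤˣ (Metric.sphere (0 : EuclideanSpace ℝ (Fin (n + 1))) 1) :=
  ⟨fun g x => ⟨((g : ℤ) : ℝ) • (x : EuclideanSpace ℝ (Fin (n + 1))), by
    have hx := x.2
    have hg : |((g : ℤ) : ℝ)| = 1 := by
      rcases Int.units_eq_one_or g with h | h <;> simp [h]
    simp only [mem_sphere_iff_norm, sub_zero, norm_smul, Real.norm_eq_abs, hg,
      one_mul] at *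
    exact hx⟩⟩

instance sphereAntipodalAction (n : ℕ) :
    MulAction ℤˣ (Metric.sphere (0 : EuclideanSpace ℝ (Fin (n + 1))) 1) where
  one_smul x := by
    apply Subtype.ext
    show (((1 : ℤˣ) : ℤ) : ℝ) • (x : EuclideanSpace ℝ (Fin (n + 1))) = x
    simp
  mul_smul g h x := by
    apply Subtype.ext
    show (((g * h : ℤˣ) : ℤ) : ℝ) • (x : EuclideanSpace ℝ (Fin (n + 1))) =
      ((g : ℤ) : ℝ) • (((h : ℤ) : ℝ) • (x : EuclideanSpace ℝ (Fin (n + 1))))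
    push_cast
    rw [smul_smul]


section Degree

open MeasureTheory Filter Topology Module

variable {E : Type*} [NormedAddCommGroup E] [NormedSpace ℝ E] [FiniteDimensional ℝ E]

theorem det_smul_id_add_pos {A : E →L[ℝ] E} {C s : ℝ} (hA : ‖A‖ ≤ C) (hs : C < s) :
    0 < (s • ContinuousLinearMap.id ℝ E + A).det := by
  have hC : 0 ≤ C := (norm_nonneg A).trans hA
  set f : ℝ → ℝ := fun t => (s • ContinuousLinearMap.id ℝ E + t • A).det with hf
  have hcont : Continuous f := by
    apply ContinuousLinearMap.continuous_det.comp
    fun_prop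
  have hne : ∀ t ∈ Icc (0 : ℝ) 1, f t ≠ 0 := by
    intro t ht h0
    obtain ⟨x, hx, hx0⟩ := (Submodule.ne_bot_iff _).1
      (bot_lt_iff_ne_bot.1 (LinearMap.bot_lt_ker_of_det_eq_zero h0))
    have hx' : s • x = -(t • A x) := by
      have : s • x + t • A x = 0 := by simpa using hx
      exact eq_neg_of_add_eq_zero_left this
    have hxpos : 0 < ‖x‖ := norm_pos_iff.2 hx0
    have h1 : ‖s • x‖ = s * ‖x‖ := by
      rw [norm_smul, Real.norm_eq_abs, abs_of_pos (hC.trans_lt hs)]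
    have h2 : ‖t • A x‖ ≤ C * ‖x‖ := by
      rw [norm_smul, Real.norm_eq_abs, abs_of_nonneg ht.1]
      calc t * ‖A x‖ ≤ 1 * ‖A x‖ := by gcongr; exact ht.2
        _ = ‖A x‖ := one_mul _
        _ ≤ C * ‖x‖ := A.le_of_opNorm_le hA x
    rw [hx', norm_neg] at h1
    nlinarith
  have h0 : 0 < f 0 := by
    have : f 0 = s ^ finrank ℝ E := by
      simp [hf, ContinuousLinearMap.det]
    rw [this]
    exact pow_pos (hC.trans_lt hs) _
  by_contra hneg
  have h1 : f 1 ≤ 0 := by simpa [hf] using hneg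
  obtain ⟨t, ht, ht0⟩ := intermediate_value_Icc' zero_le_one hcont.continuousOn ⟨h1, h0.le⟩
  exact hne t ht ht0

theorem bijective_smul_id_add {w : E → E} {C : NNReal} (hw : LipschitzWith C w) {s : ℝ}
    (hs : (C : ℝ) < s) : Function.Bijective fun x => s • x + w x := by
  have hs0 : 0 < s := C.2.trans_lt hs
  constructor
  · intro x y hxy
    have h1 : s • (x - y) = w y - w x := by
      have : s • x + w x = s • y + w y := hxy
      rw [smul_sub, sub_eq_sub_iff_add_eq_add, this, add_comm]
    have h2 : s * ‖x - y‖ ≤ C * ‖x - y‖ := by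
      have := hw.dist_le_mul y x
      rw [dist_eq_norm, dist_eq_norm, ← h1, norm_smul, Real.norm_eq_abs, abs_of_pos hs0,
        norm_sub_rev y x] at this
      exact this
    have h3 : ‖x - y‖ = 0 := by nlinarith [norm_nonneg (x - y)]
    exact sub_eq_zero.1 (norm_eq_zero.1 h3)
  · intro y
    have hK : ContractingWith (C / s.toNNReal) fun x => s⁻¹ • (y - w x) := by
      refine ⟨?_, ?_⟩
      · rw [div_lt_one (by simpa using hs0)]
        exact NNReal.coe_lt_coe.1 (by simpa [hs0.le] using hs)
      · refine LipschitzWith.of_dist_le_mul fun a b => ?_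
        rw [dist_smul₀, dist_sub_left]
        have := hw.dist_le_mul a b
        simp only [norm_inv, Real.norm_eq_abs, abs_of_pos hs0, NNReal.coe_div,
          Real.coe_toNNReal _ hs0.le]
        calc s⁻¹ * dist (w a) (w b) ≤ s⁻¹ * (C * dist a b) := by gcongr
          _ = _ := by ring
    refine ⟨hK.fixedPoint _, ?_⟩
    have : s⁻¹ • (y - w (hK.fixedPoint _)) = hK.fixedPoint _ := hK.fixedPoint_isFixedPt
    have h2 : s • hK.fixedPoint _ = y - w (hK.fixedPoint _) := by
      conv_lhs => rw [← this]
      rw [smul_inv_smul₀ hs0.ne']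
    simp only
    rw [h2]; abel

variable [MeasurableSpace E] [BorelSpace E] (μ : Measure E) [μ.IsAddHaarMeasure]

theorem setIntegral_det_smul_id_add {w : E → E} (hw : ContDiff ℝ 1 w) {C : NNReal}
    (hC : LipschitzWith C w) {B : Set E} (hB : IsOpen B)
    (hwB : ∀ x ∉ B, w x = 0) {s : ℝ} (hs : (C : ℝ) < s) :
    ∫ x in B, (s • ContinuousLinearMap.id ℝ E + fderiv ℝ w x).det ∂μ =
      s ^ finrank ℝ E * μ.real B := by
  have hs0 : 0 < s := C.2.trans_lt hs
  have hbij := bijective_smul_id_add hC hs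
  set G : E → E := fun x => s • x + w x with hG
  have hder : ∀ x, HasFDerivAt G (s • ContinuousLinearMap.id ℝ E + fderiv ℝ w x) x := by
    intro x
    exact ((hasFDerivAt_id x).const_smul s).add
      (hw.differentiable one_ne_zero x).hasFDerivAt
  have himg : G '' B = (fun x => s • x) '' B := by
    have hb2 : Function.Bijective fun x : E => s • x :=
      (MulAction.bijective (Units.mk0 s hs0.ne') : _)
    have h1 : G '' Bᶜ = (fun x => s • x) '' Bᶜ :=
      image_congr fun x hx => by simp [hG, hwB x hx]
    rw [image_compl_eq hbij, image_compl_eq hb2] at h1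
    exact compl_injective h1
  have hI := integral_image_eq_integral_abs_det_fderiv_smul μ hB.measurableSet
    (fun x _ => (hder x).hasFDerivWithinAt) hbij.1.injOn (fun _ => (1 : ℝ))
  have hvol : ∫ _ in G '' B, (1 : ℝ) ∂μ = s ^ finrank ℝ E * μ.real B := by
    rw [himg, setIntegral_const, Set.image_smul, measureReal_def, Measure.addHaar_smul]
    simp [measureReal_def, abs_of_pos hs0, ENNReal.toReal_mul, hs0.le]
  rw [← hvol, hI]
  refine integral_congr_ae (Eventually.of_forall fun x => ?_)
  have := det_smul_id_add_pos (norm_fderiv_le_of_lipschitz ℝ hC (x₀ := x)) hs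
  simp only [smul_eq_mul, mul_one]
  rw [abs_of_pos this]

/-- The Jacobian determinant of a compactly supported map has integral zero. -/
theorem integral_det_fderiv_eq_zero [Nontrivial E] {w : E → E} (hw : ContDiff ℝ 1 w)
    (hc : HasCompactSupport w) : ∫ x, (fderiv ℝ w x).det ∂μ = 0 := by
  obtain ⟨C, hC⟩ := hw.lipschitzWith_of_hasCompactSupport hc one_ne_zero
  obtain ⟨R, hR⟩ := hc.isBounded.subset_ball (0 : E)
  set B := Metric.ball (0 : E) R with hBdef
  have hwB : ∀ x ∉ B, w x = 0 := fun x hx => image_eq_zero_of_notMem_tsupport fun h => hx (hR h)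
  set N := finrank ℝ E with hN
  have hN0 : N ≠ 0 := finrank_pos.ne'
  set v : ℕ → ℝ := fun j => C + 1 + j with hv
  have hvinj : Set.InjOn v (Finset.range (N + 1)) := by
    intro a _ b _ h
    simpa [hv] using h
  set S := Finset.range (N + 1) with hS
  set c : ℕ → ℝ := fun j => (Lagrange.basis S v j).eval 0 with hcdef
  have hlag : ∀ p : Polynomial ℝ, p.natDegree ≤ N → p.eval 0 = ∑ j ∈ S, p.eval (v j) * c j := by
    intro p hp
    have hdeg : p.degree < S.card := by
      rw [hS, Finset.card_range]
      exact (Polynomial.degree_le_of_natDegree_le hp).trans_lt (by exact_mod_cast Nat.lt_succ_self N)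
    conv_lhs => rw [Lagrange.eq_interpolate hvinj hdeg, Lagrange.interpolate_apply]
    simp [Polynomial.eval_finsetSum, hcdef]
  have hchar : ∀ (x : E) (s : ℝ), (-(fderiv ℝ w x : E →ₗ[ℝ] E)).charpoly.eval s =
      (s • ContinuousLinearMap.id ℝ E + fderiv ℝ w x).det := by
    intro x s
    rw [LinearMap.eval_charpoly, ContinuousLinearMap.det]
    congr 1
    ext y
    simp
  have hdet : ∀ x, (fderiv ℝ w x).det =
      ∑ j ∈ S, (v j • ContinuousLinearMap.id ℝ E + fderiv ℝ w x).det * c j := by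
    intro x
    have h := hlag (-(fderiv ℝ w x : E →ₗ[ℝ] E)).charpoly (LinearMap.charpoly_natDegree _).le
    rw [hchar] at h
    simp only [hchar, zero_smul, zero_add] at h
    exact h
  have hout : ∀ x ∉ B, (fderiv ℝ w x).det = 0 := by
    intro x hx
    have : fderiv ℝ w x = 0 :=
      image_eq_zero_of_notMem_tsupport fun h => hx (hR (tsupport_fderiv_subset ℝ h))
    rw [this, ContinuousLinearMap.det]
    simp
  rw [← setIntegral_eq_integral_of_forall_compl_eq_zero hout]
  simp_rw [hdet]
  have hcontdet : ∀ s : ℝ, Continuous fun x =>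
      (s • ContinuousLinearMap.id ℝ E + fderiv ℝ w x).det := by
    intro s
    have := hw.continuous_fderiv one_ne_zero
    exact ContinuousLinearMap.continuous_det.comp (by fun_prop)
  rw [integral_finsetSum]
  · have : ∀ j ∈ S, ∫ x in B, (v j • ContinuousLinearMap.id ℝ E + fderiv ℝ w x).det * c j ∂μ =
        (Polynomial.X ^ N : Polynomial ℝ).eval (v j) * c j * μ.real B := by
      intro j _
      rw [integral_mul_const, setIntegral_det_smul_id_add μ hw hC Metric.isOpen_ball hwB]
      · simp; ring
      · simp only [hv]
        have : (0 : ℝ) ≤ j := Nat.cast_nonneg j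
        linarith
    rw [Finset.sum_congr rfl this, ← Finset.sum_mul, ← hlag _ (by simp)]
    simp [hN0]
  · intro j _
    refine (((hcontdet (v j)).mul continuous_const).continuousOn.integrableOn_compact
      (isCompact_closedBall 0 R)).mono_set Metric.ball_subset_closedBall

theorem setIntegral_det_fderiv_congr [Nontrivial E] {f g : E → E} {Ω K : Set E}
    (hΩ : IsOpen Ω) (hf : ContDiffOn ℝ 1 f Ω) (hg : ContDiffOn ℝ 1 g Ω) (hK : IsCompact K)
    (hKΩ : K ⊆ Ω) (hfg : EqOn f g (Ω \ K)) :
    ∫ x in K, (fderiv ℝ f x).det ∂μ = ∫ x in K, (fderiv ℝ g x).det ∂μ := by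
  obtain ⟨L, hL, hKL, hLΩ⟩ := exists_compact_between hK hΩ hKΩ
  obtain ⟨χ, hχ1, hχ0, -⟩ := exists_contMDiffMap_one_nhds_of_subset_interior
    (n := 1) (modelWithCornersSelf ℝ E) hK.isClosed hKL
  have hχ : ContDiff ℝ 1 χ := χ.contMDiff.contDiff
  have hsm : ∀ f : E → E, ContDiffOn ℝ 1 f Ω → ContDiff ℝ 1 fun x => χ x • f x := by
    intro f hf
    rw [contDiff_iff_contDiffAt]
    intro x
    by_cases hx : x ∈ Ω
    · exact hχ.contDiffAt.smul (hf.contDiffAt (hΩ.mem_nhds hx))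
    · have hx' : Lᶜ ∈ 𝓝 x := hL.isClosed.isOpen_compl.mem_nhds fun h => hx (hLΩ h)
      refine (contDiffAt_const (c := (0 : E))).congr_of_eventuallyEq ?_
      filter_upwards [hx'] with y hy
      simp [hχ0 y hy]
  have hcs : ∀ f : E → E, HasCompactSupport fun x => χ x • f x := fun f =>
    HasCompactSupport.intro hL fun x hx => by simp [hχ0 x hx]
  have h_integrable : ∀ f : E → E, ContDiffOn ℝ 1 f Ω →
      Integrable (fun x => (fderiv ℝ (fun x => χ x • f x) x).det) μ := by
    intro f hf
    refine Continuous.integrable_of_hasCompactSupport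
      (ContinuousLinearMap.continuous_det.comp ((hsm f hf).continuous_fderiv one_ne_zero))
      (HasCompactSupport.intro hL fun x hx => ?_)
    have : fderiv ℝ (fun x => χ x • f x) x = 0 := by
      have h : (fun x => χ x • f x) =ᶠ[𝓝 x] fun _ => 0 := by
        filter_upwards [hL.isClosed.isOpen_compl.mem_nhds hx] with y hy
        simp [hχ0 y hy]
      rw [h.fderiv_eq]; simp
    rw [this]; simp [ContinuousLinearMap.det]
  have hon : ∀ f : E → E, ∫ x in K, (fderiv ℝ (fun x => χ x • f x) x).det ∂μ =
      ∫ x in K, (fderiv ℝ f x).det ∂μ := by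
    intro f
    refine setIntegral_congr_fun hK.measurableSet fun x hx => ?_
    have h : (fun x => χ x • f x) =ᶠ[𝓝 x] f := by
      filter_upwards [(eventually_nhdsSet_iff_forall.1 hχ1) x hx] with y hy
      simp [hy]
    simp only [h.fderiv_eq]
  have hoff : ∫ x in Kᶜ, (fderiv ℝ (fun x => χ x • f x) x).det ∂μ =
      ∫ x in Kᶜ, (fderiv ℝ (fun x => χ x • g x) x).det ∂μ := by
    refine setIntegral_congr_fun hK.measurableSet.compl fun x hx => ?_
    have h : (fun x => χ x • f x) =ᶠ[𝓝 x] fun x => χ x • g x := by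
      filter_upwards [hK.isClosed.isOpen_compl.mem_nhds hx] with y hy
      by_cases hyΩ : y ∈ Ω
      · rw [hfg ⟨hyΩ, hy⟩]
      · simp [hχ0 y fun h => hyΩ (hLΩ h)]
    simp only [h.fderiv_eq]
  have h1 := integral_add_compl hK.measurableSet (h_integrable f hf)
  have h2 := integral_add_compl hK.measurableSet (h_integrable g hg)
  rw [integral_det_fderiv_eq_zero μ (hsm f hf) (hcs f), hon] at h1
  rw [integral_det_fderiv_eq_zero μ (hsm g hg) (hcs g), hon] at h2
  linarith

theorem exists_contDiff_deriv_bump {δ : ℝ} (hδ : 0 < δ) : ∃ ψ : ℝ → ℝ, ContDiff ℝ 1 ψ ∧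
    (∀ t, 0 ≤ deriv ψ t) ∧ 0 < deriv ψ 0 ∧ ∀ t, δ ≤ |t| → deriv ψ t = 0 := by
  set β : ℝ → ℝ := fun t => max 0 (δ - |t|) with hβ
  have hβc : Continuous β := by fun_prop
  have hd : ∀ t, HasDerivAt (fun t => ∫ s in (0 : ℝ)..t, β s) (β t) t := fun t =>
    intervalIntegral.integral_hasDerivAt_right (hβc.intervalIntegrable _ _)
      (hβc.stronglyMeasurableAtFilter _ _) hβc.continuousAt
  have hd' : deriv (fun t => ∫ s in (0 : ℝ)..t, β s) = β := funext fun t => (hd t).deriv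
  refine ⟨fun t => ∫ s in (0 : ℝ)..t, β s, ?_, ?_, ?_, ?_⟩
  · rw [contDiff_one_iff_deriv, hd']
    exact ⟨fun t => (hd t).differentiableAt, hβc⟩
  · intro t; rw [hd']; exact le_max_left _ _
  · rw [hd']; simp [hβ, hδ]
  · intro t ht; rw [hd']; simp [hβ, ht]

variable {ι : Type*} [Fintype ι]

theorem det_fderiv_comp_coordinates {ψ : ℝ → ℝ} (hψ : Differentiable ℝ ψ)
    {f : (ι → ℝ) → ι → ℝ} {x : ι → ℝ} (hf : DifferentiableAt ℝ f x) :
    (fderiv ℝ (fun y j => ψ (f y j)) x).det =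
      (∏ j, deriv ψ (f x j)) * (fderiv ℝ f x).det := by
  classical
  have h : HasFDerivAt (fun (v : ι → ℝ) j => ψ (v j))
      (LinearMap.toContinuousLinearMap
        (Matrix.toLin' (Matrix.diagonal fun j => deriv ψ (f x j)))) (f x) := by
    rw [hasFDerivAt_pi']
    intro j
    have h1 := ((hψ (f x j)).hasDerivAt.hasFDerivAt).comp (f x)
      (ContinuousLinearMap.proj (R := ℝ) (φ := fun _ : ι => ℝ) j).hasFDerivAt
    refine h1.congr_fderiv ?_
    ext v
    simp [Matrix.mulVec_diagonal, mul_comm]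
  have h2 := (h.comp x hf.hasFDerivAt).fderiv
  have h3 : (fun y j => ψ (f y j)) = (fun (v : ι → ℝ) j => ψ (v j)) ∘ f := rfl
  rw [h3, h2, ContinuousLinearMap.det, ContinuousLinearMap.toLinearMap_comp, LinearMap.det_comp]
  simp [ContinuousLinearMap.det]

/-- A map which agrees outside a compact set with a map of positive degree has a zero
(coordinate version). -/
theorem exists_zero_of_eqOn_diff_compact_pi [Nonempty ι] {Ω K : Set (ι → ℝ)}
    {f g : (ι → ℝ) → ι → ℝ} (hΩ : IsOpen Ω) (hf : ContDiffOn ℝ 1 f Ω)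
    (hpos : ∀ x ∈ Ω, f x = 0 → 0 < (fderiv ℝ f x).det) {x₀ : ι → ℝ} (hx₀ : x₀ ∈ Ω)
    (hfx₀ : f x₀ = 0) (hg : ContinuousOn g Ω) (hK : IsCompact K) (hKΩ : K ⊆ Ω)
    (hfg : EqOn g f (Ω \ K)) : ∃ x ∈ Ω, g x = 0 := by
  by_contra! hne
  have hx₀K : x₀ ∈ K := by
    by_contra h
    exact hne x₀ hx₀ (by rw [hfg ⟨hx₀, h⟩, hfx₀])
  obtain ⟨L, hL, hKL, hLΩ⟩ := exists_compact_between hK hΩ hKΩ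
  have hLne : L.Nonempty := ⟨x₀, interior_subset (hKL hx₀K)⟩
  obtain ⟨a, ha, hmin⟩ := hL.exists_isMinOn hLne (hg.mono hLΩ).norm
  have hapos : 0 < ‖g a‖ := norm_pos_iff.2 (hne a (hLΩ ha))
  have hcd : ContinuousOn (fun x => (fderiv ℝ f x).det) Ω :=
    ContinuousLinearMap.continuous_det.comp_continuousOn
      (hf.continuousOn_fderiv_of_isOpen hΩ le_rfl)
  have hbad : ∃ η > 0, ∀ x ∈ L, (fderiv ℝ f x).det ≤ 0 → η ≤ ‖f x‖ := by
    have hbc : IsCompact (L ∩ {x | x ∈ L ∧ (fderiv ℝ f x).det ≤ 0}) := by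
      have : IsClosed {x | x ∈ L ∧ (fderiv ℝ f x).det ≤ 0} :=
        (hcd.mono hLΩ).preimage_isClosed_of_isClosed hL.isClosed isClosed_Iic
      exact hL.inter_right this
    rcases (L ∩ {x | x ∈ L ∧ (fderiv ℝ f x).det ≤ 0}).eq_empty_or_nonempty with h | h
    · refine ⟨1, one_pos, fun x hx hx' => ?_⟩
      exact absurd (show x ∈ (L ∩ {x | x ∈ L ∧ (fderiv ℝ f x).det ≤ 0}) from ⟨hx, hx, hx'⟩)
        (by simp [h])
    · obtain ⟨b, hb, hbmin⟩ := hbc.exists_isMinOn h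
        ((hf.continuousOn.mono hLΩ).mono inter_subset_left).norm
      refine ⟨‖f b‖, norm_pos_iff.2 fun h0 => ?_, fun x hx hx' => hbmin ⟨hx, hx, hx'⟩⟩
      exact absurd (hpos b (hLΩ hb.1) h0) (not_lt.2 hb.2.2)
  obtain ⟨η, hη, hηL⟩ := hbad
  set δ := min (‖g a‖ / 2) η with hδdef
  have hδ : 0 < δ := lt_min (by positivity) hη
  obtain ⟨ψ, hψ, hψ0, hψpos, hψδ⟩ := exists_contDiff_deriv_bump hδ
  have hprod : ∀ v : ι → ℝ, δ ≤ ‖v‖ → ∏ j, deriv ψ (v j) = 0 := by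
    intro v hv
    obtain ⟨j, hj⟩ := Finite.exists_max fun j => ‖v j‖
    have : ‖v‖ ≤ ‖v j‖ := (pi_norm_le_iff_of_nonneg (norm_nonneg _)).2 hj
    exact Finset.prod_eq_zero (Finset.mem_univ j) (hψδ _ (hv.trans this))
  -- a smooth approximation of `g`
  set u : (ι → ℝ) → ι → ℝ := K.indicator fun x => g x - f x with hu
  have huΩ : EqOn u (fun x => g x - f x) Ω := by
    intro x hx
    by_cases hxK : x ∈ K
    · simp [hu, hxK]
    · simp [hu, hxK, hfg ⟨hx, hxK⟩]
  have hucont : Continuous u := by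
    rw [continuous_iff_continuousAt]
    intro x
    by_cases hx : x ∈ Ω
    · have : ContinuousAt (fun x => g x - f x) x :=
        (hg.sub hf.continuousOn).continuousAt (hΩ.mem_nhds hx)
      exact this.congr (huΩ.eventuallyEq_of_mem (hΩ.mem_nhds hx)).symm
    · have : u =ᶠ[𝓝 x] fun _ => 0 := by
        filter_upwards [hK.isClosed.isOpen_compl.mem_nhds fun h => hx (hKΩ h)] with y hy
        simp only [mem_compl_iff] at hy
        simp [hu, hy]
      exact continuousAt_const.congr this.symm
  obtain ⟨u', hu'c, hu'u, hu's⟩ := hucont.exists_contDiff_approx 1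
    (ε := fun _ => ‖g a‖ / 2) continuous_const (fun _ => by positivity)
  set g' : (ι → ℝ) → ι → ℝ := fun x => f x + u' x with hg'
  have hg'c : ContDiffOn ℝ 1 g' Ω := hf.add (hu'c.contDiffOn (n := 1))
  have hg'f : EqOn f g' (Ω \ L) := by
    intro x hx
    have : u' x = 0 := by
      by_contra h
      have : u x ≠ 0 := hu's h
      exact hx.2 (interior_subset (hKL (by
        by_contra hxK
        exact this (by simp [hu, hxK]))))
    simp [hg', this]
  have hg'norm : ∀ x ∈ L, δ ≤ ‖g' x‖ := by
    intro x hx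
    have h1 : ‖g a‖ ≤ ‖g x‖ := hmin hx
    have h2 : ‖g' x - g x‖ < ‖g a‖ / 2 := by
      have := hu'u x
      rw [huΩ (hLΩ hx), dist_eq_norm] at this
      have h3 : g' x - g x = u' x - (g x - f x) := by simp only [hg']; abel
      rwa [h3]
    have h3 : ‖g x‖ ≤ ‖g' x‖ + ‖g' x - g x‖ := by
      have := norm_sub_le (g' x) (g' x - g x)
      simpa using this
    exact (min_le_left _ _).trans (by linarith)
  -- compare the integrals of the Jacobians
  have hρ : ∀ f : (ι → ℝ) → ι → ℝ, ContDiffOn ℝ 1 f Ω →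
      ContDiffOn ℝ 1 (fun y j => ψ (f y j)) Ω := by
    intro f hf
    exact contDiffOn_pi.2 fun j => hψ.comp_contDiffOn (contDiffOn_pi.1 hf j)
  have hψd := hψ.differentiable one_ne_zero
  have key := setIntegral_det_fderiv_congr (volume : Measure (ι → ℝ)) hΩ (hρ f hf) (hρ g' hg'c)
    hL hLΩ (fun x hx => by simp only [hg'f hx])
  have hda : ∀ f : (ι → ℝ) → ι → ℝ, ContDiffOn ℝ 1 f Ω → ∀ x ∈ Ω, DifferentiableAt ℝ f x :=
    fun f hf x hx => (hf.contDiffAt (hΩ.mem_nhds hx)).differentiableAt one_ne_zero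
  have hzero : ∫ x in L, (fderiv ℝ (fun y j => ψ (g' y j)) x).det = 0 := by
    rw [setIntegral_congr_fun hL.measurableSet (g := fun _ => 0), integral_zero]
    intro x hx
    simp only
    rw [det_fderiv_comp_coordinates hψd (hda g' hg'c x (hLΩ hx)), hprod _ (hg'norm x hx),
      zero_mul]
  have hcont : ContinuousOn (fun x => (fderiv ℝ (fun y j => ψ (f y j)) x).det) Ω :=
    ContinuousLinearMap.continuous_det.comp_continuousOn
      ((hρ f hf).continuousOn_fderiv_of_isOpen hΩ le_rfl)
  have hnn : ∀ x ∈ L, 0 ≤ (fderiv ℝ (fun y j => ψ (f y j)) x).det := by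
    intro x hx
    rw [det_fderiv_comp_coordinates hψd (hda f hf x (hLΩ hx))]
    by_cases hd : (fderiv ℝ f x).det ≤ 0
    · rw [hprod _ ((min_le_right _ _).trans (hηL x hx hd)), zero_mul]
    · exact mul_nonneg (Finset.prod_nonneg fun j _ => hψ0 _) (not_le.1 hd).le
  have hx₀pos : 0 < (fderiv ℝ (fun y j => ψ (f y j)) x₀).det := by
    rw [det_fderiv_comp_coordinates hψd (hda f hf x₀ hx₀)]
    refine mul_pos (Finset.prod_pos fun j _ => ?_) (hpos x₀ hx₀ hfx₀)
    rw [hfx₀]; exact hψpos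
  have hposint : 0 < ∫ x in L, (fderiv ℝ (fun y j => ψ (f y j)) x).det := by
    rw [setIntegral_pos_iff_support_of_nonneg_ae
      ((ae_restrict_iff' hL.measurableSet).2 (Eventually.of_forall hnn))
      ((hcont.mono hLΩ).integrableOn_compact hL)]
    have hnhds : {x | 0 < (fderiv ℝ (fun y j => ψ (f y j)) x).det} ∩ interior L ∈ 𝓝 x₀ :=
      inter_mem ((hcont.continuousAt (hΩ.mem_nhds hx₀)).eventually (lt_mem_nhds hx₀pos))
        (isOpen_interior.mem_nhds (hKL hx₀K))
    refine (Measure.measure_pos_of_mem_nhds volume hnhds).trans_le (measure_mono ?_)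
    exact fun x hx => ⟨ne_of_gt hx.1, interior_subset hx.2⟩
  rw [key, hzero] at hposint
  exact lt_irrefl _ hposint

end Degree

section Degree

open Module

variable {E : Type*} [NormedAddCommGroup E] [NormedSpace ℝ E] [FiniteDimensional ℝ E]

/-- A map which agrees outside a compact set with a map of positive degree has a zero. -/
theorem exists_zero_of_eqOn_diff_compact [Nontrivial E] {Ω K : Set E}
    {f g : E → E} (hΩ : IsOpen Ω) (hf : ContDiffOn ℝ 1 f Ω)
    (hpos : ∀ x ∈ Ω, f x = 0 → 0 < (fderiv ℝ f x).det) {x₀ : E} (hx₀ : x₀ ∈ Ω)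
    (hfx₀ : f x₀ = 0) (hg : ContinuousOn g Ω) (hK : IsCompact K) (hKΩ : K ⊆ Ω)
    (hfg : EqOn g f (Ω \ K)) : ∃ x ∈ Ω, g x = 0 := by
  obtain ⟨e⟩ : Nonempty (E ≃L[ℝ] (Fin (finrank ℝ E) → ℝ)) :=
    ⟨ContinuousLinearEquiv.ofFinrankEq (by simp)⟩
  have : Nonempty (Fin (finrank ℝ E)) := ⟨⟨0, finrank_pos⟩⟩
  have hmaps : MapsTo e.symm (e.symm ⁻¹' Ω) Ω := fun _ h => h
  obtain ⟨x, hx, hx0⟩ := exists_zero_of_eqOn_diff_compact_pi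
    (f := fun y => e (f (e.symm y))) (g := fun y => e (g (e.symm y)))
    (Ω := e.symm ⁻¹' Ω) (K := e '' K) (x₀ := e x₀)
    (hΩ.preimage e.symm.continuous)
    (e.contDiff.comp_contDiffOn (hf.comp e.symm.contDiff.contDiffOn hmaps))
    (fun y hy hy0 => by
      have hfy : f (e.symm y) = 0 := by simpa using hy0
      have hd : HasFDerivAt f (fderiv ℝ f (e.symm y)) (e.symm y) :=
        ((hf.contDiffAt (hΩ.mem_nhds hy)).differentiableAt one_ne_zero).hasFDerivAt
      have h1 := e.hasFDerivAt.comp y (hd.comp y e.symm.hasFDerivAt)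
      have h2 : fderiv ℝ (fun y => e (f (e.symm y))) y = _ := h1.fderiv
      rw [h2, ContinuousLinearMap.det]
      have h3 := LinearMap.det_conj (fderiv ℝ f (e.symm y) : E →ₗ[ℝ] E) e.toLinearEquiv
      have h4 := hpos _ hy hfy
      rw [ContinuousLinearMap.det, ← h3] at h4
      exact h4)
    (by simpa using hx₀) (by simp [hfx₀])
    (e.continuous.comp_continuousOn (hg.comp e.symm.continuous.continuousOn hmaps))
    (hK.image e.continuous)
    (by rintro _ ⟨y, hy, rfl⟩; simpa using hKΩ hy)
    (fun y hy => by
      have : g (e.symm y) = f (e.symm y) :=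
        hfg ⟨hy.1, fun h => hy.2 ⟨e.symm y, h, by simp⟩⟩
      simp [this])
  exact ⟨e.symm x, hx, by simpa using hx0⟩

end Degree

section MotionPlanner

variable {X : Type*} [TopologicalSpace X]

theorem exists_deformation_of_section [NormalSpace (X × X)] {U C : Set (X × X)}
    (hU : IsOpen U) (hC : IsClosed C) (hCU : C ⊆ U) (s : C(U, C(I, X)))
    (hs : ∀ u : U, pathEval X (s u) = (u : X × X)) :
    ∃ h : (X × X) × I → X, Continuous h ∧ (∀ z, h (z, 0) = z.1) ∧
      ∀ z ∈ C, h (z, 1) = z.2 := by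
  classical
  obtain ⟨l, hl0, hl1, -⟩ := exists_continuous_zero_one_of_isClosed hU.isClosed_compl hC
    (by rwa [← subset_compl_iff_disjoint_left, compl_compl])
  set τ : X × X → I := fun z => projIcc 0 1 zero_le_one (2 * l z - 1) with hτ
  have hτc : Continuous τ := by
    refine continuous_projIcc.comp ?_
    fun_prop
  have hτ0 : ∀ z, l z < 1 / 2 → τ z = 0 := fun z hz =>
    projIcc_of_le_left zero_le_one (by linarith)
  refine ⟨fun p => if hp : p.1 ∈ U then s ⟨p.1, hp⟩ (τ p.1 * p.2) else p.1.1, ?_, ?_, ?_⟩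
  · rw [continuous_iff_continuousAt]
    intro p
    by_cases hp : p.1 ∈ U
    · have hopen : IsOpen (Prod.fst ⁻¹' U : Set ((X × X) × I)) := hU.preimage continuous_fst
      refine ContinuousOn.continuousAt (s := Prod.fst ⁻¹' U) ?_ (hopen.mem_nhds hp)
      rw [continuousOn_iff_continuous_domRestrict]
      have h1 : Continuous fun q : (Prod.fst ⁻¹' U : Set ((X × X) × I)) =>
          s ⟨q.1.1, q.2⟩ (τ q.1.1 * q.1.2) := by
        have hs' : Continuous fun q : U × I => s q.1 q.2 := by fun_prop
        exact hs'.comp ((Continuous.subtype_mk (by fun_prop) _).prodMk (by fun_prop))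
      refine h1.congr fun q => ?_
      have : q.1.1 ∈ U := q.2
      simp [this]
    · have hlp : l p.1 < 1 / 2 := by rw [hl0 hp]; norm_num
      have hev : ∀ᶠ q : (X × X) × I in nhds p, l q.1 < 1 / 2 :=
        ((l.continuous.comp continuous_fst).continuousAt (x := p)).eventually (gt_mem_nhds hlp)
      refine ContinuousAt.congr (f := fun q : (X × X) × I => q.1.1) (by fun_prop) ?_
      filter_upwards [hev] with q hq
      by_cases hqU : q.1 ∈ U
      · have := congrArg Prod.fst (hs ⟨q.1, hqU⟩)
        simp only [pathEval] at this
        simp [hqU, hτ0 q.1 hq, this]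
      · simp [hqU]
  · intro z
    by_cases hz : z ∈ U
    · have := congrArg Prod.fst (hs ⟨z, hz⟩)
      simp only [pathEval] at this
      simp [hz, this]
    · simp [hz]
  · intro z hz
    have hzU := hCU hz
    have h1 : τ z = 1 := projIcc_of_right_le zero_le_one (by rw [hl1 hz]; norm_num)
    have := congrArg Prod.snd (hs ⟨z, hzU⟩)
    simp only [pathEval] at this
    simp [hzU, h1, this]

/-- A cover by domains of motion planners yields globally defined deformations of the first
projection which reach the second projection on a cover. -/
theorem TCCover.exists_deformations [NormalSpace (X × X)] {m : ℕ} (hX : TCCover X m) :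
    ∃ h : Fin (m + 1) → (X × X) × I → X, (∀ j, Continuous (h j)) ∧
      (∀ j z, h j (z, 0) = z.1) ∧ ∀ z, ∃ j, h j (z, 1) = z.2 := by
  obtain ⟨U, hU, hcov, hs⟩ := hX
  obtain ⟨C, hCcov, hC, hCU⟩ := exists_iUnion_eq_closed_subset hU
    (fun _ => Set.toFinite _) hcov
  choose s hs using hs
  choose h h1 h2 h3 using fun j => exists_deformation_of_section (hU j) (hC j) (hCU j) (s j) (hs j)
  refine ⟨h, h1, h2, fun z => ?_⟩
  obtain ⟨j, hj⟩ := mem_iUnion.1 (hCcov ▸ mem_univ z : z ∈ ⋃ i, C i)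
  exact ⟨j, h3 j z hj⟩

theorem EqTCCover.tcCover {G : Type*} [Group G] [MulAction G X] {m : ℕ}
    (h : EqTCCover G X m) : TCCover X m := by
  obtain ⟨U, hU, hcov, -, hs⟩ := h
  exact ⟨U, hU, hcov, fun i => (hs i).imp fun s hs => hs.1⟩

end MotionPlanner

section BlockDet

/-- The determinant of a block diagonal endomorphism of a dependent product is the product of
the determinants of the blocks. -/
theorem det_pi_comp_proj {ι : Type*} [Fintype ι] [LinearOrder ι] {M : ι → Type*}
    [∀ i, AddCommGroup (M i)] [∀ i, Module ℝ (M i)] [∀ i, Module.Finite ℝ (M i)]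
    (f : ∀ i, M i →ₗ[ℝ] M i) :
    LinearMap.det (LinearMap.pi fun i => (f i).comp (LinearMap.proj i)) =
      ∏ i, LinearMap.det (f i) := by
  let b := fun i => Module.Free.chooseBasis ℝ (M i)
  let B := Pi.basis b
  rw [← LinearMap.det_toMatrix B]
  have hentry : ∀ p q, LinearMap.toMatrix B B
      (LinearMap.pi fun i => (f i).comp (LinearMap.proj i)) p q =
      (b p.1).repr (f p.1 ((Pi.single q.1 (b q.1 q.2) : ∀ i, M i) p.1)) p.2 := by
    intro p q
    simp [B, LinearMap.toMatrix_apply, Pi.basis_repr, Pi.basis_apply]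
  rw [Matrix.BlockTriangular.det_fintype (b := fun p => p.1)]
  · refine Finset.prod_congr rfl fun i _ => ?_
    rw [← LinearMap.det_toMatrix (b i), ← Matrix.det_submatrix_equiv_self
      (Equiv.sigmaSubtype i).symm]
    congr 1
    ext p q
    rw [LinearMap.toMatrix_apply]
    exact (hentry ⟨i, p⟩ ⟨i, q⟩).trans (by simp)
  · intro p q hpq
    rw [hentry, Pi.single_eq_of_ne (ne_of_gt hpq)]
    simp

variable {V : Type*} [NormedAddCommGroup V] [InnerProductSpace ℝ V]

/-- The orthogonal projection away from a vector `e` (for `e` of norm one). -/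
def orthoPart (e : V) : V →L[ℝ] V :=
  ContinuousLinearMap.id ℝ V - (innerSL ℝ e).smulRight e

@[simp] theorem orthoPart_apply (e b : V) : orthoPart e b = b - inner ℝ e b • e := by
  simp [orthoPart]

theorem det_pos_of_add_self {W : Type*} [AddCommGroup W] [Module ℝ W] {g : W →ₗ[ℝ] W}
    (hg : g ∘ₗ g = 0) : 0 < LinearMap.det (LinearMap.id + g) := by
  have h1 : (LinearMap.id + g : W →ₗ[ℝ] W) =
      (LinearMap.id + (1 / 2 : ℝ) • g) ∘ₗ (LinearMap.id + (1 / 2 : ℝ) • g) := by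
    ext x
    have hx : g (g x) = 0 := LinearMap.congr_fun hg x
    simp only [LinearMap.add_apply, LinearMap.id_apply, LinearMap.smul_apply, LinearMap.comp_apply,
      map_add, map_smul, hx]
    module
  have h2 : (LinearMap.id + g : W →ₗ[ℝ] W) ∘ₗ (LinearMap.id - g) = LinearMap.id := by
    ext x
    have hx : g (g x) = 0 := LinearMap.congr_fun hg x
    simp [hx]
  have h3 : LinearMap.det (LinearMap.id + g) ≠ 0 := by
    intro h
    have := congrArg LinearMap.det h2
    rw [LinearMap.det_comp, h, LinearMap.det_id, zero_mul] at this
    exact zero_ne_one this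
  refine lt_of_le_of_ne ?_ h3.symm
  rw [h1, LinearMap.det_comp]
  exact mul_self_nonneg _

theorem det_id_sub_smul_orthoPart_pos [FiniteDimensional ℝ V] {e : V} (he : ‖e‖ = 1) (hodd : Odd (Module.finrank ℝ V))
    {c : ℝ} (hc : c ≠ 1) :
    0 < LinearMap.det (LinearMap.id - c • (orthoPart e : V →ₗ[ℝ] V)) := by
  have hc' : 1 - c ≠ 0 := sub_ne_zero.2 hc.symm
  have h : (LinearMap.id - c • (orthoPart e : V →ₗ[ℝ] V)) =
      (1 - c) • LinearMap.transvection ((innerSL ℝ e : V →L[ℝ] ℝ) : V →ₗ[ℝ] ℝ)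
        ((c / (1 - c)) • e) := by
    ext x
    simp only [LinearMap.sub_apply, LinearMap.id_apply, LinearMap.smul_apply,
      ContinuousLinearMap.coe_coe, orthoPart_apply, LinearMap.transvection.apply, innerSL_apply_apply,
      smul_add, smul_smul]
    have : (1 - c) * (inner ℝ e x * (c / (1 - c))) = c * inner ℝ e x := by field_simp
    rw [this]
    module
  rw [h, LinearMap.det_smul, LinearMap.transvection.det]
  simp only [ContinuousLinearMap.coe_coe, innerSL_apply_apply, inner_smul_right,
    real_inner_self_eq_norm_sq, he]
  obtain ⟨m, hm⟩ := hodd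
  rw [hm, pow_succ, pow_mul, mul_assoc]
  have : (1 - c) * (1 + c / (1 - c) * 1 ^ 2) = 1 := by field_simp; ring
  rw [this, mul_one]
  positivity

/-- The linearization of the comparison map at a zero. -/
def sphereBlock (e : V) (c : ℝ) : V × V →L[ℝ] V × V :=
  (ContinuousLinearMap.fst ℝ V V + (orthoPart e).comp (ContinuousLinearMap.snd ℝ V V)).prod
    (c • (orthoPart e).comp (ContinuousLinearMap.fst ℝ V V) + ContinuousLinearMap.snd ℝ V V)

@[simp] theorem sphereBlock_apply (e : V) (c : ℝ) (p : V × V) :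
    sphereBlock e c p = (p.1 + orthoPart e p.2, c • orthoPart e p.1 + p.2) := by
  simp [sphereBlock]

theorem det_sphereBlock_pos [FiniteDimensional ℝ V] {e : V} (he : ‖e‖ = 1) {c : ℝ}
    (hc : c = 0 ∨ (Odd (Module.finrank ℝ V) ∧ c ≠ 1)) :
    0 < LinearMap.det (sphereBlock e c : V × V →ₗ[ℝ] V × V) := by
  have hP : ∀ b : V, orthoPart e (orthoPart e b) = orthoPart e b := fun b => by
    simp [inner_sub_right, inner_smul_right, he]
  let g₁ : V × V →ₗ[ℝ] V × V :=
    (-((orthoPart e : V →ₗ[ℝ] V) ∘ₗ LinearMap.snd ℝ V V)).prod 0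
  let g₂ : V × V →ₗ[ℝ] V × V :=
    LinearMap.prod 0 (-(c • (orthoPart e : V →ₗ[ℝ] V) ∘ₗ LinearMap.fst ℝ V V))
  have h₁ := det_pos_of_add_self (g := g₁) (by ext <;> simp [g₁])
  have h₂ := det_pos_of_add_self (g := g₂) (by ext <;> simp [g₂])
  have h₃ : 0 < LinearMap.det (LinearMap.id - c • (orthoPart e : V →ₗ[ℝ] V)) := by
    rcases hc with rfl | ⟨hodd, hc⟩
    · simp
    · exact det_id_sub_smul_orthoPart_pos he hodd hc
  have hcomp : (LinearMap.id + g₂) ∘ₗ (sphereBlock e c : V × V →ₗ[ℝ] V × V) ∘ₗ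
      (LinearMap.id + g₁) =
      LinearMap.prodMap LinearMap.id (LinearMap.id - c • (orthoPart e : V →ₗ[ℝ] V)) := by
    refine LinearMap.ext fun ⟨x, w⟩ => ?_
    simp only [LinearMap.comp_apply, LinearMap.add_apply, LinearMap.id_apply, g₁, g₂,
      LinearMap.prod_apply, Function.prod, LinearMap.neg_apply, LinearMap.zero_apply,
      ContinuousLinearMap.coe_coe, sphereBlock_apply, LinearMap.snd_apply, LinearMap.fst_apply,
      LinearMap.smul_apply, map_add, map_neg, hP, add_zero,
      Prod.mk_add_mk, LinearMap.prodMap_apply, LinearMap.sub_apply]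
    generalize hv : orthoPart e w = v
    generalize orthoPart e x = u
    refine Prod.ext ?_ ?_
    · dsimp only
      abel
    · dsimp only
      module
  have := congrArg LinearMap.det hcomp
  rw [LinearMap.det_comp, LinearMap.det_comp, LinearMap.det_prodMap, LinearMap.det_id,
    one_mul] at this
  rw [← this] at h₃
  exact (pos_iff_pos_of_mul_pos ((pos_iff_pos_of_mul_pos h₃).1 h₂)).2 h₁

end BlockDet

section Comparison

variable {V : Type*} [NormedAddCommGroup V] [InnerProductSpace ℝ V]

theorem hasFDerivAt_normalize {x : V} (hx : x ≠ 0) :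
    HasFDerivAt (fun y : V => ‖y‖⁻¹ • y) (‖x‖⁻¹ • orthoPart (‖x‖⁻¹ • x)) x := by
  have hx' : ‖x‖ ≠ 0 := norm_ne_zero_iff.2 hx
  have h1 : HasFDerivAt (fun y : V => ‖y‖ ^ 2) (2 • innerSL ℝ x) x :=
    (hasStrictFDerivAt_norm_sq x).hasFDerivAt
  have h2 := h1.sqrt (by positivity)
  simp only [Real.sqrt_sq (norm_nonneg _)] at h2
  have h3 := (hasDerivAt_inv hx').comp_hasFDerivAt x h2
  have h4 := h3.smul (hasFDerivAt_id x)
  refine h4.congr_fderiv ?_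
  ext b
  simp only [add_apply, smul_apply,
    ContinuousLinearMap.smulRight_apply, ContinuousLinearMap.id_apply, orthoPart_apply,
    innerSL_apply_apply, real_inner_smul_left, smul_sub, smul_smul, Function.comp_apply, id,
    smul_eq_mul, nsmul_eq_mul, Nat.cast_ofNat]
  rw [sub_eq_add_neg, ← neg_smul]
  congr 2
  field_simp

/-- The comparison map on one factor. -/
def sphereCompare (e : V) (a : ℝ) (p : V × V) : V × V :=
  (p.1 + ‖p.2‖⁻¹ • p.2 + (1 / 2 : ℝ) • e, a • ‖p.1‖⁻¹ • p.1 + p.2 - (1 - a) • e)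

theorem contDiffAt_sphereCompare (e : V) (a : ℝ) {p : V × V} (h1 : p.1 ≠ 0) (h2 : p.2 ≠ 0) :
    ContDiffAt ℝ 1 (sphereCompare e a) p := by
  have hn : ∀ x : V, x ≠ 0 → ContDiffAt ℝ 1 (fun y : V => ‖y‖⁻¹ • y) x := fun x hx =>
    ((contDiffAt_norm ℝ hx).inv (norm_ne_zero_iff.2 hx)).smul contDiffAt_id
  have hn1 : ContDiffAt ℝ 1 (fun p : V × V => ‖p.1‖⁻¹ • p.1) p := (hn _ h1).comp p contDiffAt_fst
  have hn2 : ContDiffAt ℝ 1 (fun p : V × V => ‖p.2‖⁻¹ • p.2) p := (hn _ h2).comp p contDiffAt_snd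
  exact ((contDiffAt_fst.add hn2).add contDiffAt_const).prodMk
    (((contDiffAt_const.smul hn1).add contDiffAt_snd).sub contDiffAt_const)

theorem orthoPart_neg (e : V) : orthoPart (-e) = orthoPart e := by
  ext b; simp

theorem exists_sphereCompare_eq_zero {e : V} (he : ‖e‖ = 1) {a : ℝ} (ha : a = 0 ∨ a = 1) :
    ∃ p : V × V, p.1 ≠ 0 ∧ p.2 ≠ 0 ∧ sphereCompare e a p = 0 := by
  have he0 : e ≠ 0 := by rintro rfl; simp at he
  rcases ha with rfl | rfl
  · refine ⟨((-(3 / 2) : ℝ) • e, e), by simp [he0], he0, ?_⟩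
    refine Prod.ext ?_ ?_ <;> simp only [sphereCompare, he, Prod.fst_zero, Prod.snd_zero]
    · module
    · module
  · refine ⟨((1 / 2 : ℝ) • e, -e), by simp [he0], by simp [he0], ?_⟩
    refine Prod.ext ?_ ?_ <;>
      simp only [sphereCompare, he, Prod.fst_zero, Prod.snd_zero, norm_smul, norm_neg]
    · module
    · norm_num [smul_smul]

/-- At a zero of the comparison map its derivative is one of the maps `sphereBlock e c`. -/
theorem hasFDerivAt_sphereCompare {e : V} (he : ‖e‖ = 1) {a : ℝ} (ha : a = 0 ∨ a = 1)
    {p : V × V} (h1 : p.1 ≠ 0) (h2 : p.2 ≠ 0) (hp : sphereCompare e a p = 0) :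
    ∃ c : ℝ, (a = 0 ∧ c = 0 ∨ a = 1 ∧ c ≠ 1) ∧
      HasFDerivAt (sphereCompare e a) (sphereBlock e c) p := by
  obtain ⟨x, w⟩ := p
  have hx' : ‖x‖ ≠ 0 := norm_ne_zero_iff.2 h1
  have hp1 : x + ‖w‖⁻¹ • w + (1 / 2 : ℝ) • e = 0 := congrArg Prod.fst hp
  have hp2 : a • ‖x‖⁻¹ • x + w - (1 - a) • e = 0 := congrArg Prod.snd hp
  have hw1 : ‖w‖ = 1 := by
    rcases ha with rfl | rfl
    · have : w = e := by simpa [sub_eq_zero] using hp2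
      rw [this, he]
    · have : w = -(‖x‖⁻¹ • x) := by
        simp only [one_smul, sub_self, zero_smul, sub_zero] at hp2
        exact (neg_eq_of_add_eq_zero_right hp2).symm
      rw [this, norm_neg, norm_smul, norm_inv, norm_norm, inv_mul_cancel₀ hx']
  rw [hw1, inv_one, one_smul] at hp1
  have hder : HasFDerivAt (sphereCompare e a)
      ((ContinuousLinearMap.fst ℝ V V +
          (‖w‖⁻¹ • orthoPart (‖w‖⁻¹ • w)).comp (ContinuousLinearMap.snd ℝ V V)).prod
        (a • (‖x‖⁻¹ • orthoPart (‖x‖⁻¹ • x)).comp (ContinuousLinearMap.fst ℝ V V) +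
          ContinuousLinearMap.snd ℝ V V)) (x, w) := by
    have hf : HasFDerivAt (fun p : V × V => ‖p.1‖⁻¹ • p.1) _ (x, w) :=
      (hasFDerivAt_normalize (x := (x, w).1) h1).comp (x, w) hasFDerivAt_fst
    have hs : HasFDerivAt (fun p : V × V => ‖p.2‖⁻¹ • p.2) _ (x, w) :=
      (hasFDerivAt_normalize (x := (x, w).2) h2).comp (x, w) hasFDerivAt_snd
    exact ((hasFDerivAt_fst.add hs).add_const _).prodMk
      (((hf.const_smul a).add hasFDerivAt_snd).sub_const _)
  have key : orthoPart w = orthoPart e ∧ (a = 0 ∨ a = 1 ∧ ‖x‖ ≠ 1 ∧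
      orthoPart (‖x‖⁻¹ • x) = orthoPart e) := by
    rcases ha with rfl | rfl
    · have : w = e := by simpa [sub_eq_zero] using hp2
      exact ⟨by rw [this], Or.inl rfl⟩
    · have hw : w = -(‖x‖⁻¹ • x) := by
        simp only [one_smul, sub_self, zero_smul, sub_zero] at hp2
        exact (neg_eq_of_add_eq_zero_right hp2).symm
      have hxw : x = -(‖x‖ • w) := by rw [hw, smul_neg, neg_neg, smul_inv_smul₀ hx']
      have hew : e = (2 * (‖x‖ - 1)) • w := by
        have h3 : (1 / 2 : ℝ) • e = (‖x‖ - 1) • w := by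
          have h4 : (1 / 2 : ℝ) • e = -(x + w) := (neg_eq_of_add_eq_zero_right hp1).symm
          rw [h4]
          nth_rw 1 [hxw]
          module
        rw [mul_smul, ← h3, smul_smul]
        norm_num
      have hne : ‖x‖ ≠ 1 := by
        intro h
        rw [h, sub_self, mul_zero, zero_smul] at hew
        rw [hew] at he
        simp at he
      have habs : |2 * (‖x‖ - 1)| = 1 := by
        have := congrArg norm hew
        rw [he, norm_smul, hw1, mul_one, Real.norm_eq_abs] at this
        exact this.symm
      have how : orthoPart w = orthoPart e := by
        rcases (abs_eq zero_le_one).1 habs with h | h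
        · rw [hew, h, one_smul]
        · rw [hew, h, neg_one_smul, orthoPart_neg]
      refine ⟨how, Or.inr ⟨rfl, hne, ?_⟩⟩
      rw [← how, hw, orthoPart_neg]
  obtain ⟨how, rfl | ⟨rfl, hne, hox⟩⟩ := key
  · refine ⟨0, Or.inl ⟨rfl, rfl⟩, hder.congr_fderiv ?_⟩
    simp [sphereBlock, hw1, how]
  · refine ⟨‖x‖⁻¹, Or.inr ⟨rfl, fun h => hne (by simpa using h)⟩, hder.congr_fderiv ?_⟩
    rw [hw1, hox, inv_one, one_smul, one_smul, one_smul, how]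
    rfl

end Comparison

section SphereNormalize

variable {V : Type*} [NormedAddCommGroup V] [InnerProductSpace ℝ V]

open Classical in
/-- Normalization of a vector to the unit sphere, with value `e` at the origin. -/
def normalizeSphere (e : Metric.sphere (0 : V) 1) (x : V) : Metric.sphere (0 : V) 1 :=
  if h : x = 0 then e else ⟨‖x‖⁻¹ • x, by
    rw [mem_sphere_zero_iff_norm, norm_smul, norm_inv, norm_norm,
      inv_mul_cancel₀ (norm_ne_zero_iff.2 h)]⟩

theorem coe_normalizeSphere (e : Metric.sphere (0 : V) 1) {x : V} (hx : x ≠ 0) :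
    (normalizeSphere e x : V) = ‖x‖⁻¹ • x := by
  simp [normalizeSphere, hx]

theorem continuousOn_normalizeSphere (e : Metric.sphere (0 : V) 1) :
    ContinuousOn (normalizeSphere e) {0}ᶜ := by
  rw [Topology.IsInducing.subtypeVal.continuousOn_iff]
  refine ContinuousOn.congr (f := fun x : V => ‖x‖⁻¹ • x) ?_
    fun x hx => coe_normalizeSphere e hx
  exact (continuousOn_id.norm.inv₀ fun x hx => norm_ne_zero_iff.2 hx).smul continuousOn_id

end SphereNormalize

/-- Uniformly in a family of unit spheres, there are no deformations of the first projection
of a product of spheres whose coordinates reach all pairs of points, if only one coordinate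
deformation is used for a general sphere and two are used for even spheres. -/
theorem exists_deformations_ne {ι : Type*} [Fintype ι] [Nonempty ι] [LinearOrder ι]
    {V : ι → Type*} [∀ i, NormedAddCommGroup (V i)] [∀ i, InnerProductSpace ℝ (V i)]
    [∀ i, FiniteDimensional ℝ (V i)] (A : ι → Prop)
    (hA : ∀ i, A i → Odd (Module.finrank ℝ (V i))) (e : ∀ i, Metric.sphere (0 : V i) 1)
    {h₁ h₂ : ∀ i, ((Π i, Metric.sphere (0 : V i) 1) × (Π i, Metric.sphere (0 : V i) 1)) × I →
      Metric.sphere (0 : V i) 1}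
    (hc₁ : ∀ i, Continuous (h₁ i)) (hc₂ : ∀ i, Continuous (h₂ i))
    (hs₁ : ∀ i z, h₁ i (z, 0) = z.1 i) (hs₂ : ∀ i z, h₂ i (z, 0) = z.1 i) :
    ∃ z, ∀ i, h₁ i (z, 1) ≠ z.2 i ∧ (A i → h₂ i (z, 1) ≠ z.2 i) := by
  classical
  by_contra! hcon
  let a : ι → ℝ := fun i => if A i then 1 else 0
  have ha : ∀ i, a i = 0 ∨ a i = 1 := fun i => by
    by_cases h : A i <;> simp [a, h]
  have he : ∀ i, ‖(e i : V i)‖ = 1 := fun i => norm_eq_of_mem_sphere _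
  let E := Π i, V i × V i
  let Ω : Set E := {q | ∀ i, (q i).1 ≠ 0 ∧ (q i).2 ≠ 0}
  have hΩ : IsOpen Ω := by
    have : Ω = ⋂ i, ({q : E | (q i).1 ≠ 0} ∩ {q : E | (q i).2 ≠ 0}) := by
      ext q; simp [Ω]
    rw [this]
    refine isOpen_iInter_of_finite fun i => IsOpen.inter ?_ ?_
    · exact isOpen_ne_fun (by fun_prop) (by fun_prop)
    · exact isOpen_ne_fun (by fun_prop) (by fun_prop)
  let θ : E → (Π i, Metric.sphere (0 : V i) 1) × (Π i, Metric.sphere (0 : V i) 1) := fun q =>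
    (fun i => normalizeSphere (e i) (q i).1, fun i => normalizeSphere (e i) (q i).2)
  have hθ : ContinuousOn θ Ω := by
    refine ContinuousOn.prodMk ?_ ?_ <;> refine continuousOn_pi.2 fun i => ?_
    · exact (continuousOn_normalizeSphere (e i)).comp (by fun_prop) fun q hq => (hq i).1
    · exact (continuousOn_normalizeSphere (e i)).comp (by fun_prop) fun q hq => (hq i).2
  let J : ∀ i, Set (V i) := fun i => Metric.closedBall 0 2 ∩ {x | 1 / 2 ≤ ‖x‖}
  have hJ : ∀ i, IsCompact (J i) := fun i =>
    (isCompact_closedBall 0 2).inter_right (isClosed_le continuous_const continuous_norm)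
  let R : Set E := Set.pi univ fun i => J i ×ˢ J i
  have hR : IsCompact R := isCompact_univ_pi fun i => (hJ i).prod (hJ i)
  have hJ0 : ∀ i, ∀ x ∈ J i, x ≠ 0 := by
    rintro i x ⟨-, hx⟩ rfl
    simp only [mem_ofPred_eq, norm_zero] at hx
    linarith
  have hRΩ : R ⊆ Ω := fun q hq i =>
    ⟨hJ0 i _ (hq i (mem_univ i)).1, hJ0 i _ (hq i (mem_univ i)).2⟩
  obtain ⟨K, hK, hRK, hKΩ⟩ := exists_compact_between hR hΩ hRΩ
  obtain ⟨l, hl1, hl0, -, -⟩ := exists_continuous_one_zero_of_isCompact hR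
    isOpen_interior.isClosed_compl (disjoint_compl_right_iff_subset.2 hRK)
  let τ : E → I := fun q => projIcc 0 1 zero_le_one (l q)
  have hτc : Continuous τ := continuous_projIcc.comp l.continuous
  have hτ1 : ∀ q ∈ R, τ q = 1 := fun q hq =>
    projIcc_of_right_le zero_le_one (by rw [hl1 hq]; norm_num)
  have hτ0 : ∀ q ∉ K, τ q = 0 := fun q hq =>
    projIcc_of_le_left zero_le_one (by rw [hl0 fun h => hq (interior_subset h)]; norm_num)
  let F₀ : E → E := fun q i => sphereCompare (e i : V i) (a i) (q i)
  let F : E → E := fun q i =>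
    (‖(q i).1‖ • (h₁ i (θ q, τ q) : V i) + ‖(q i).2‖⁻¹ • (q i).2 + (1 / 2 : ℝ) • (e i : V i),
      a i • (h₂ i (θ q, τ q) : V i) + (q i).2 - (1 - a i) • (e i : V i))
  have hF₀ : ContDiffOn ℝ 1 F₀ Ω := fun q hq => by
    refine (contDiffAt_pi.2 fun i => ?_).contDiffWithinAt
    exact ContDiffAt.comp (g := sphereCompare (e i : V i) (a i)) (f := fun q : E => q i) q
      (contDiffAt_sphereCompare _ _ (hq i).1 (hq i).2)
      (ContinuousLinearMap.proj (R := ℝ) (φ := fun i => V i × V i) i).contDiff.contDiffAt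
  have hF : ContinuousOn F Ω := by
    have hθτ : ContinuousOn (fun q => (θ q, τ q)) Ω := hθ.prodMk hτc.continuousOn
    refine continuousOn_pi.2 fun i => ?_
    have k₁ : ContinuousOn (fun q => (h₁ i (θ q, τ q) : V i)) Ω :=
      (continuous_subtype_val.comp (hc₁ i)).comp_continuousOn hθτ
    have k₂ : ContinuousOn (fun q => (h₂ i (θ q, τ q) : V i)) Ω :=
      (continuous_subtype_val.comp (hc₂ i)).comp_continuousOn hθτ
    have k₃ : ContinuousOn (fun q : E => ‖(q i).2‖⁻¹) Ω :=
      ContinuousOn.inv₀ (by fun_prop) fun q hq => norm_ne_zero_iff.2 (hq i).2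
    have k₄ : ContinuousOn (fun q : E => ‖(q i).1‖) Ω := by fun_prop
    have k₅ : ContinuousOn (fun q : E => (q i).2) Ω := by fun_prop
    exact (((k₄.smul k₁).add (k₃.smul k₅)).add continuousOn_const).prodMk
      (((continuousOn_const.smul k₂).add k₅).sub continuousOn_const)
  have hFF₀ : EqOn F F₀ (Ω \ K) := fun q hq => by
    funext i
    have hx := (hq.1 i).1
    simp only [F, F₀, hτ0 q hq.2, hs₁, hs₂, θ, sphereCompare, coe_normalizeSphere _ hx]
    rw [smul_inv_smul₀ (norm_ne_zero_iff.2 hx)]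
  have hpos : ∀ q ∈ Ω, F₀ q = 0 → 0 < (fderiv ℝ F₀ q).det := fun q hq h0 => by
    choose c hc hd using fun i => hasFDerivAt_sphereCompare (he i) (ha i) (hq i).1 (hq i).2
      (congrFun h0 i)
    have hder : HasFDerivAt F₀ (ContinuousLinearMap.pi fun i =>
        (sphereBlock (e i : V i) (c i)).comp (ContinuousLinearMap.proj i)) q :=
      hasFDerivAt_pi.2 fun i => HasFDerivAt.comp (g := sphereCompare (e i : V i) (a i))
        (f := fun q : E => q i) q (hd i)
        (ContinuousLinearMap.proj (R := ℝ) (φ := fun i => V i × V i) i).hasFDerivAt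
    rw [hder.fderiv]
    refine lt_of_lt_of_eq (Finset.prod_pos fun i _ => det_sphereBlock_pos (he i) (c := c i) ?_)
      (det_pi_comp_proj fun i => (sphereBlock (e i : V i) (c i) : V i × V i →ₗ[ℝ] V i × V i)).symm
    rcases hc i with ⟨-, h⟩ | ⟨h1, h2⟩
    · exact Or.inl h
    · refine Or.inr ⟨hA i ?_, h2⟩
      by_contra h
      simp [a, h] at h1
  choose q₀ hq₀ using fun i => exists_sphereCompare_eq_zero (he i) (ha i)
  have : Nontrivial E := by
    obtain ⟨i⟩ := ‹Nonempty ι›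
    exact ⟨q₀, 0, fun h => (hq₀ i).1 (congrArg Prod.fst (congrFun h i))⟩
  obtain ⟨q, hq, hFq⟩ := exists_zero_of_eqOn_diff_compact hΩ hF₀ hpos
    (x₀ := q₀) (fun i => ⟨(hq₀ i).1, (hq₀ i).2.1⟩) (funext fun i => (hq₀ i).2.2) hF hK hKΩ hFF₀
  have hFq1 : ∀ i, ‖(q i).1‖ • (h₁ i (θ q, τ q) : V i) + ‖(q i).2‖⁻¹ • (q i).2 +
      (1 / 2 : ℝ) • (e i : V i) = 0 := fun i => congrArg Prod.fst (congrFun hFq i)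
  have hFq2 : ∀ i, a i • (h₂ i (θ q, τ q) : V i) + (q i).2 - (1 - a i) • (e i : V i) = 0 :=
    fun i => congrArg Prod.snd (congrFun hFq i)
  have hw : ∀ i, ‖(q i).2‖ = 1 := fun i => by
    have h2 := hFq2 i
    rcases ha i with h | h
    · have : (q i).2 = e i := by simpa [h, sub_eq_zero] using h2
      rw [this, he]
    · have : (q i).2 = -(h₂ i (θ q, τ q) : V i) := by
        simp only [h, one_smul, sub_self, zero_smul, sub_zero] at h2
        exact (neg_eq_of_add_eq_zero_right h2).symm
      rw [this, norm_neg]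
      exact norm_eq_of_mem_sphere _
  have hq1 : ∀ i, ‖(q i).1‖ • (h₁ i (θ q, τ q) : V i) + (q i).2 + (1 / 2 : ℝ) • (e i : V i) = 0 :=
    fun i => by simpa [hw i] using hFq1 i
  have hθ2 : ∀ i, ((θ q).2 i : V i) = (q i).2 := fun i => by
    simp [θ, coe_normalizeSphere _ (hq i).2, hw i]
  have hqR : q ∈ R := fun i _ => by
    have h1 : ‖(q i).1‖ = ‖(q i).2 + (1 / 2 : ℝ) • (e i : V i)‖ := by
      have := (neg_eq_of_add_eq_zero_right ((add_assoc _ _ _).symm.trans (hq1 i))).symm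
      rw [this, norm_neg, norm_smul, norm_norm, norm_eq_of_mem_sphere, mul_one]
    have h2 : ‖(1 / 2 : ℝ) • (e i : V i)‖ = 1 / 2 := by
      rw [norm_smul, he, mul_one]; norm_num
    have h3 := norm_add_le (q i).2 ((1 / 2 : ℝ) • (e i : V i))
    have h4 := norm_sub_norm_le (q i).2 (-((1 / 2 : ℝ) • (e i : V i)))
    rw [norm_neg, sub_neg_eq_add] at h4
    rw [hw, h2] at h3 h4
    refine ⟨⟨?_, ?_⟩, ?_, ?_⟩ <;>
      simp only [mem_closedBall_zero_iff, mem_ofPred_eq, hw, h1] <;> linarith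
  obtain ⟨i, hi⟩ := hcon (θ q)
  rw [hτ1 q hqR] at hq1 hFq2
  by_cases h : h₁ i (θ q, 1) = (θ q).2 i
  · have h1 := hq1 i
    rw [h, hθ2] at h1
    have h2 : (‖(q i).1‖ + 1) • (q i).2 = -((1 / 2 : ℝ) • (e i : V i)) := by
      refine eq_neg_of_add_eq_zero_left (Eq.trans ?_ h1)
      module
    have h3 := congrArg norm h2
    rw [norm_neg, norm_smul, norm_smul, hw, he, Real.norm_of_nonneg (by positivity)] at h3
    norm_num at h3
    linarith [norm_nonneg (q i).1]
  · obtain ⟨hAi, h⟩ := hi h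
    have h1 := hFq2 i
    have ha1 : a i = 1 := by simp [a, hAi]
    rw [h, hθ2, ha1, one_smul, sub_self, zero_smul, sub_zero, ← two_smul ℝ] at h1
    exact (hq i).2 ((smul_eq_zero.1 h1).resolve_left two_ne_zero)

/-- The lower bound for the topological complexity of a product of spheres. -/
theorem TCCover.add_card_even_le {r : ℕ} (hr : 0 < r) (n : Fin r → ℕ) {m : ℕ}
    (hX : TCCover (Π i, Metric.sphere (0 : EuclideanSpace ℝ (Fin (n i + 1))) 1) m) :
    r + (Finset.univ.filter fun i => Even (n i)).card ≤ m := by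
  by_contra! hlt
  have : Nonempty (Fin r) := ⟨⟨0, hr⟩⟩
  obtain ⟨h, hc, h0, h1⟩ := hX.exists_deformations
  obtain ⟨φ⟩ : Nonempty (Fin (m + 1) ↪ Fin r ⊕ {i : Fin r // Even (n i)}) := by
    refine Function.Embedding.nonempty_of_card_le ?_
    rw [Fintype.card_fin, Fintype.card_sum, Fintype.card_fin, Fintype.card_subtype]
    exact hlt
  let f := Function.invFun φ
  have hf : ∀ j, f (φ j) = j := Function.leftInverse_invFun φ.injective
  obtain ⟨z, hz⟩ := exists_deformations_ne (fun i => Even (n i))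
    (fun i hi => by rw [finrank_euclideanSpace_fin]; exact hi.add_one)
    (fun i => ⟨EuclideanSpace.single 0 1, by simp⟩)
    (h₁ := fun i z => h (f (Sum.inl i)) z i)
    (h₂ := fun i z => if hi : Even (n i) then h (f (Sum.inr ⟨i, hi⟩)) z i else h 0 z i)
    (fun i => (continuous_apply i).comp (hc _))
    (fun i => by split_ifs <;> exact (continuous_apply i).comp (hc _))
    (fun i z => by rw [h0]) (fun i z => by split_ifs <;> rw [h0])
  obtain ⟨j, hj⟩ := h1 z
  rcases hφ : φ j with i | ⟨i, hi⟩
  · refine (hz i).1 ?_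
    rw [← hφ, hf, hj]
  · refine (hz i).2 hi ?_
    rw [dif_pos hi, ← hφ, hf, hj]

section Gluing

variable {ι : Type*} {X : ι → Type*}

/-- The pairs of points of a product for which some common level `t ∈ (0, 1)` separates, in the
`i`-th factor, the values of the cut functions number `J i` and `J i + 1`. -/
def cutCell (s : ∀ i, ℕ → X i × X i → ℝ) (J : ι → ℕ) : Set ((Π i, X i) × (Π i, X i)) :=
  {z | ∃ t ∈ Ioo (0 : ℝ) 1, ∀ i, s i (J i) (z.1 i, z.2 i) < t ∧
    t < s i (J i + 1) (z.1 i, z.2 i)}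

theorem isOpen_cutCell [Finite ι] [∀ i, TopologicalSpace (X i)] {s : ∀ i, ℕ → X i × X i → ℝ}
    (hs : ∀ i j, Continuous (s i j)) (J : ι → ℕ) : IsOpen (cutCell s J) := by
  have : cutCell s J = ⋃ t ∈ Ioo (0 : ℝ) 1, ⋂ i,
      {z : (Π i, X i) × (Π i, X i) | s i (J i) (z.1 i, z.2 i) < t} ∩
        {z | t < s i (J i + 1) (z.1 i, z.2 i)} := by
    ext z; simp [cutCell]
  rw [this]
  refine isOpen_biUnion fun t _ => isOpen_iInter_of_finite fun i => IsOpen.inter ?_ ?_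
  · exact isOpen_lt ((hs i _).comp (by fun_prop)) continuous_const
  · exact isOpen_lt continuous_const ((hs i _).comp (by fun_prop))

theorem le_or_le_of_mem_cutCell {s : ∀ i, ℕ → X i × X i → ℝ}
    (hmono : ∀ i z, Monotone fun j => s i j z) {J J' : ι → ℕ} {z : (Π i, X i) × (Π i, X i)}
    (hz : z ∈ cutCell s J) (hz' : z ∈ cutCell s J') : J ≤ J' ∨ J' ≤ J := by
  have key : ∀ {J J' : ι → ℕ} {t t' : ℝ}, (∀ i, s i (J i) (z.1 i, z.2 i) < t) →
      (∀ i, t' < s i (J' i + 1) (z.1 i, z.2 i)) → t ≤ t' → J ≤ J' := by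
    intro J J' t t' h h' htt i
    by_contra! hlt
    have := hmono i (z.1 i, z.2 i) (Nat.succ_le_of_lt hlt)
    have h1 := h i
    have h2 := h' i
    simp only [Nat.succ_eq_add_one] at this
    linarith
  obtain ⟨t, -, ht⟩ := hz
  obtain ⟨t', -, ht'⟩ := hz'
  rcases le_total t t' with h | h
  · exact Or.inl (key (fun i => (ht i).1) (fun i => (ht' i).2) h)
  · exact Or.inr (key (fun i => (ht' i).1) (fun i => (ht i).2) h)

theorem eq_of_mem_cutCell [Fintype ι] {s : ∀ i, ℕ → X i × X i → ℝ}
    (hmono : ∀ i z, Monotone fun j => s i j z) {J J' : ι → ℕ} {z : (Π i, X i) × (Π i, X i)}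
    (hz : z ∈ cutCell s J) (hz' : z ∈ cutCell s J') (hJ : ∑ i, J i = ∑ i, J' i) : J = J' := by
  rcases le_or_le_of_mem_cutCell hmono hz hz' with h | h
  · funext i
    exact (Finset.sum_eq_sum_iff_of_le fun i _ => h i).1 hJ i (Finset.mem_univ i)
  · funext i
    exact ((Finset.sum_eq_sum_iff_of_le fun i _ => h i).1 hJ.symm i (Finset.mem_univ i)).symm

theorem exists_mem_cutCell [Fintype ι] {s : ∀ i, ℕ → X i × X i → ℝ} {d : ι → ℕ}
    (h0 : ∀ i z, s i 0 z = 0) (h1 : ∀ i z, s i (d i + 1) z = 1) (z : (Π i, X i) × (Π i, X i)) :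
    ∃ J : ι → ℕ, (∀ i, J i ≤ d i) ∧ z ∈ cutCell s J := by
  classical
  let B : Set ℝ := ⋃ i, ⋃ j ∈ Finset.range (d i + 2), {s i j (z.1 i, z.2 i)}
  have hB : B.Finite := Set.finite_iUnion fun i =>
    Set.Finite.biUnion (Finset.finite_toSet _) fun j _ => Set.finite_singleton _
  obtain ⟨t, ht, htB⟩ := (Set.Ioo_infinite (zero_lt_one' ℝ)).exists_notMem_finite hB
  have hne : ∀ i j, j ≤ d i + 1 → s i j (z.1 i, z.2 i) ≠ t := by
    rintro i j hj rfl
    exact htB (mem_iUnion.2 ⟨i, mem_biUnion (by simpa [Nat.lt_succ_iff] using hj) rfl⟩)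
  refine ⟨fun i => Nat.findGreatest (fun j => s i j (z.1 i, z.2 i) < t) (d i),
    fun i => Nat.findGreatest_le _, t, ht, fun i => ⟨?_, ?_⟩⟩
  · exact Nat.findGreatest_spec (P := fun j => s i j (z.1 i, z.2 i) < t) (Nat.zero_le _)
      (by rw [h0]; exact ht.1)
  · dsimp only
    rcases (Nat.findGreatest_le (P := fun j => s i j (z.1 i, z.2 i) < t) (d i)).lt_or_eq with h | h
    · have := Nat.findGreatest_is_greatest (P := fun j => s i j (z.1 i, z.2 i) < t)
        (Nat.lt_succ_self _) (Nat.succ_le_of_lt h)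
      exact lt_of_le_of_ne (not_lt.1 this) (hne i _ (by omega)).symm
    · rw [h, h1]
      exact ht.2

/-- Motion planners on the factors which are organised by increasing cut functions combine to
a motion planner on the product. -/
theorem EqTCCover.pi [Fintype ι] {G : Type*} [Group G] [∀ i, TopologicalSpace (X i)] [∀ i, MulAction G (X i)]
    (d : ι → ℕ) (s : ∀ i, ℕ → X i × X i → ℝ) (P : ∀ i, ℕ → X i × X i → I → X i)
    (hs : ∀ i j, Continuous (s i j)) (hmono : ∀ i z, Monotone fun j => s i j z)
    (hG : ∀ i j (g : G) z, s i j (g • z) = s i j z)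
    (h0 : ∀ i z, s i 0 z = 0) (h1 : ∀ i z, s i (d i + 1) z = 1)
    (hP : ∀ i j, ContinuousOn (fun p : (X i × X i) × I => P i j p.1 p.2)
      {p | s i j p.1 < s i (j + 1) p.1})
    (hP0 : ∀ i j z, s i j z < s i (j + 1) z → P i j z 0 = z.1)
    (hP1 : ∀ i j z, s i j z < s i (j + 1) z → P i j z 1 = z.2)
    (hPG : ∀ i j (g : G) z t, s i j z < s i (j + 1) z → P i j (g • z) t = g • P i j z t) :
    EqTCCover G (Π i, X i) (∑ i, d i) := by
  let W : ℕ → Set ((Π i, X i) × (Π i, X i)) := fun l => {z | ∃ J : ι → ℕ, ∑ i, J i = l ∧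
    z ∈ cutCell s J}
  have hcellG : ∀ (g : G) J z, z ∈ cutCell s J → g • z ∈ cutCell s J := by
    rintro g J z ⟨t, ht, h⟩
    refine ⟨t, ht, fun i => ?_⟩
    have := h i
    rwa [← hG i _ g, ← hG i (J i + 1) g] at this
  have hlt : ∀ {J z}, z ∈ cutCell s J → ∀ i, s i (J i) (z.1 i, z.2 i) <
      s i (J i + 1) (z.1 i, z.2 i) := by
    rintro J z ⟨t, -, h⟩ i
    exact (h i).1.trans (h i).2
  refine ⟨fun l => W l, fun l => ?_, ?_, ?_, fun l => ?_⟩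
  · have : W l = ⋃ J : {J : ι → ℕ // ∑ i, J i = l}, cutCell s J := by
      ext z; simp [W]
    change IsOpen (W l)
    rw [this]
    exact isOpen_iUnion fun J => isOpen_cutCell hs J
  · refine eq_univ_of_forall fun z => ?_
    obtain ⟨J, hJ, hz⟩ := exists_mem_cutCell h0 h1 z
    exact mem_iUnion.2 ⟨⟨∑ i, J i, Nat.lt_succ_of_le (Finset.sum_le_sum fun i _ => hJ i)⟩,
      J, rfl, hz⟩
  · rintro l g z ⟨J, hJ, hz⟩
    exact ⟨J, hJ, hcellG g J z hz⟩
  · choose J hJ hz using fun z : W l => z.2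
    have huniq : ∀ (z : W l) J', ∑ i, J' i = (l : ℕ) → (z : _ × _) ∈ cutCell s J' → J z = J' :=
      fun z J' hJ' hz' => eq_of_mem_cutCell hmono (hz z) hz' ((hJ z).trans hJ'.symm)
    have hcont : Continuous fun p : W l × I => fun i =>
        P i (J p.1 i) (p.1.1.1 i, p.1.1.2 i) p.2 := by
      rw [continuous_iff_continuousAt]
      intro p
      refine continuousAt_pi.2 fun i => ?_
      have hopen : IsOpen {q : W l × I | (q.1 : _ × _) ∈ cutCell s (J p.1)} :=
        (isOpen_cutCell hs _).preimage (by fun_prop)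
      refine ContinuousOn.continuousAt ?_ (hopen.mem_nhds (hz p.1))
      refine ContinuousOn.congr (f := fun q : W l × I =>
        P i (J p.1 i) (q.1.1.1 i, q.1.1.2 i) q.2) ?_ fun q hq => ?_
      · exact (hP i (J p.1 i)).comp (f := fun q : W l × I => ((q.1.1.1 i, q.1.1.2 i), q.2))
          (by fun_prop) fun q hq => hlt hq i
      · dsimp only
        rw [huniq q.1 _ (hJ p.1) hq]
    refine ⟨ContinuousMap.curry ⟨_, hcont⟩, fun u => Prod.ext ?_ ?_, fun g u hg t => ?_⟩
    · funext i
      exact hP0 i _ _ (hlt (hz u) i)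
    · funext i
      exact hP1 i _ _ (hlt (hz u) i)
    · funext i
      have : J ⟨g • u.1, hg⟩ = J u := huniq _ _ (hJ u) (hcellG g _ _ (hz u))
      change P i (J ⟨g • u.1, hg⟩ i) (g • (u.1.1 i, u.1.2 i)) t =
        g • P i (J u i) (u.1.1 i, u.1.2 i) t
      rw [this]
      exact hPG i _ g _ t (hlt (hz u) i)

end Gluing

section Rotation

variable {V : Type*} [NormedAddCommGroup V] [InnerProductSpace ℝ V]

theorem exists_skew_euclideanSpace (m : ℕ) :
    ∃ J : EuclideanSpace ℝ (Fin m × Bool) →ₗ[ℝ] EuclideanSpace ℝ (Fin m × Bool),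
      (∀ x, inner ℝ (J x) x = 0) ∧ ∀ x, J x = 0 → x = 0 := by
  refine ⟨{ toFun := fun x => WithLp.toLp 2 fun p => (if p.2 then 1 else -1) * x (p.1, !p.2)
            map_add' := fun x y => ?_
            map_smul' := fun c x => ?_ }, fun x => ?_, fun x hx => ?_⟩
  · ext p; simp [mul_add]
  · ext p; simp [mul_left_comm]
  · simp only [PiLp.inner_apply, LinearMap.coe_mk, AddHom.coe_mk, Fintype.sum_prod_type,
      Fintype.sum_bool]
    refine Finset.sum_eq_zero fun j _ => ?_
    simp [mul_comm]
  · ext ⟨j, ε⟩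
    have := congrArg (fun y : EuclideanSpace ℝ (Fin m × Bool) => y (j, !ε)) hx
    cases ε <;> simpa using this

/-- Every subspace of even dimension carries a linear tangent field of the unit sphere which
vanishes only on the orthogonal complement of the subspace. -/
theorem exists_skew_of_even_finrank [FiniteDimensional ℝ V] (W : Submodule ℝ V)
    (hW : Even (Module.finrank ℝ W)) :
    ∃ J : V →ₗ[ℝ] V, (∀ x, inner ℝ (J x) x = 0) ∧ ∀ x, J x = 0 → x ∈ Wᗮ := by
  obtain ⟨m, hm⟩ := hW
  obtain ⟨J, hJ, hJ0⟩ := exists_skew_euclideanSpace m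
  let φ : W ≃ₗᵢ[ℝ] EuclideanSpace ℝ (Fin m × Bool) :=
    ((stdOrthonormalBasis ℝ W).reindex (Fintype.equivOfCardEq (by simp [hm]; ring))).repr
  refine ⟨W.subtype ∘ₗ φ.symm.toLinearEquiv.toLinearMap ∘ₗ J ∘ₗ φ.toLinearEquiv.toLinearMap ∘ₗ
    W.orthogonalProjectionOnto.toLinearMap, fun x => ?_, fun x hx => ?_⟩
  · have := hJ (φ (W.orthogonalProjectionOnto x))
    rw [← φ.apply_symm_apply (J _), φ.inner_map_map] at this
    simpa using this
  · have h1 : J (φ (W.orthogonalProjectionOnto x)) = 0 := by simpa using hx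
    have h2 : W.orthogonalProjectionOnto x = 0 := by simpa using hJ0 _ h1
    exact W.orthogonalProjectionOnto_eq_zero_iff.1 h2

/-- A path from `x` to `y` which first passes from `x` to `-x` in the direction `v`, and then
from `-x` to `y` along a straight segment. -/
def rotatePath (v x y : V) (t : ℝ) : V :=
  max (1 - 4 * t) (2 * t - 2) • x + (t * max 0 (1 - 2 * t)) • v + max 0 (2 * t - 1) • y

theorem rotatePath_ne_zero {v x y : V} (hx : ‖x‖ = 1) (hy : ‖y‖ = 1) (hv : v ≠ 0)
    (hvx : inner ℝ v x = 0) (hxy : x ≠ y) (t : ℝ) : rotatePath v x y t ≠ 0 := by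
  intro h
  rcases le_total t (1 / 2) with ht | ht
  · rw [rotatePath, max_eq_left (by linarith), max_eq_right (a := (0 : ℝ)) (b := 1 - 2 * t)
      (by linarith), max_eq_left (by linarith), zero_smul, add_zero] at h
    have h1 := congrArg (fun u => inner ℝ u x) h
    simp only [inner_add_left, real_inner_smul_left, hvx, real_inner_self_eq_norm_sq, hx,
      inner_zero_left] at h1
    have h2 : t = 1 / 4 := by linarith
    rw [h2] at h
    norm_num at h
    exact hv h
  · rw [rotatePath, max_eq_right (by linarith), max_eq_left (a := (0 : ℝ)) (b := 1 - 2 * t)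
      (by linarith), max_eq_right (by linarith), mul_zero, zero_smul, add_zero] at h
    have h1 : (2 - 2 * t) • x = (2 * t - 1) • y := by
      rw [← sub_eq_zero, ← neg_eq_zero, ← h]
      module
    have h2 := congrArg norm h1
    rw [norm_smul, norm_smul, hx, hy, mul_one, mul_one, Real.norm_eq_abs, Real.norm_eq_abs,
      abs_of_nonneg (a := 2 * t - 1) (by linarith)] at h2
    rcases abs_cases (2 - 2 * t) with ⟨h3, -⟩ | ⟨h3, -⟩
    · have h4 : t = 3 / 4 := by linarith
      rw [h4] at h1
      norm_num at h1
      exact hxy h1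
    · linarith

theorem rotatePath_zero (v x y : V) : rotatePath v x y 0 = x := by
  norm_num [rotatePath]

theorem rotatePath_one (v x y : V) : rotatePath v x y 1 = y := by
  norm_num [rotatePath]

theorem rotatePath_smul (c : ℝ) (v x y : V) (t : ℝ) :
    rotatePath (c • v) (c • x) (c • y) t = c • rotatePath v x y t := by
  simp only [rotatePath]
  module

theorem segment_ne_zero {x y : V} (hx : ‖x‖ = 1) (hy : ‖y‖ = 1) (hxy : x + y ≠ 0) {t : ℝ}
    (h0 : 0 ≤ t) (h1 : t ≤ 1) : (1 - t) • x + t • y ≠ 0 := by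
  intro h
  have h2 : (1 - t) • x = -(t • y) := eq_neg_of_add_eq_zero_left h
  have h3 := congrArg norm h2
  rw [norm_neg, norm_smul, norm_smul, hx, hy, mul_one, mul_one, Real.norm_of_nonneg h0,
    Real.norm_of_nonneg (by linarith)] at h3
  have h4 : t = 1 / 2 := by linarith
  rw [h4] at h
  refine hxy ?_
  have h5 := congrArg (fun u => (2 : ℝ) • u) h
  norm_num [smul_smul, smul_add] at h5
  exact h5

end Rotation

/-- On a sphere of positive dimension there are an odd tangent field which vanishes at most in a
pair of poles `±e`, and only for even spheres, and an odd tangent field which vanishes only on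
the equator. -/
theorem exists_tangent_fields {n : ℕ} (hn : 1 ≤ n) :
    ∃ (e : EuclideanSpace ℝ (Fin (n + 1)))
      (v : Bool → EuclideanSpace ℝ (Fin (n + 1)) → EuclideanSpace ℝ (Fin (n + 1))),
      ‖e‖ = 1 ∧ (∀ b, Continuous (v b)) ∧ (∀ b x, v b (-x) = -v b x) ∧
      (∀ b x, ‖x‖ = 1 → inner ℝ (v b x) x = 0) ∧
      (∀ x, ‖x‖ = 1 → (Even n → inner ℝ e x ^ 2 ≠ 1) → v false x ≠ 0) ∧
      ∀ x, ‖x‖ = 1 → inner ℝ e x ≠ 0 → v true x ≠ 0 := by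
  let e : EuclideanSpace ℝ (Fin (n + 1)) := EuclideanSpace.single 0 1
  let e' : EuclideanSpace ℝ (Fin (n + 1)) := EuclideanSpace.single (Fin.last n) 1
  have he : ‖e‖ = 1 := by simp [e]
  have he' : ‖e'‖ = 1 := by simp [e']
  have hee' : inner ℝ e e' = 0 := by
    have : Fin.last n ≠ 0 := by
      rw [Ne, Fin.ext_iff]
      simp
      omega
    simp [e, e', EuclideanSpace.inner_single_left, this.symm]
  obtain ⟨J, hJ, hJ0⟩ : ∃ J : EuclideanSpace ℝ (Fin (n + 1)) →ₗ[ℝ] EuclideanSpace ℝ (Fin (n + 1)),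
      (∀ x, inner ℝ (J x) x = 0) ∧ ∀ x, ‖x‖ = 1 → J x = 0 → Even n ∧ inner ℝ e x ^ 2 = 1 := by
    by_cases hpar : Even n
    · have : Fact (Module.finrank ℝ (EuclideanSpace ℝ (Fin (n + 1))) = n + 1) := ⟨by simp⟩
      obtain ⟨J, hJ, hJ0⟩ := exists_skew_of_even_finrank (ℝ ∙ e)ᗮ (by
        rw [Submodule.finrank_orthogonal_span_singleton (n := n) (by simp [← norm_ne_zero_iff, he])]
        exact hpar)
      refine ⟨J, hJ, fun x hx hx0 => ⟨hpar, ?_⟩⟩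
      have h1 := hJ0 x hx0
      rw [Submodule.orthogonal_orthogonal, Submodule.mem_span_singleton] at h1
      obtain ⟨c, rfl⟩ := h1
      rw [norm_smul, he, mul_one, Real.norm_eq_abs] at hx
      rw [inner_smul_right, real_inner_self_eq_norm_sq, he, one_pow, mul_one, ← sq_abs, hx, one_pow]
    · obtain ⟨J, hJ, hJ0⟩ := exists_skew_of_even_finrank
        (⊤ : Submodule ℝ (EuclideanSpace ℝ (Fin (n + 1)))) (by
          rw [finrank_top, finrank_euclideanSpace_fin]
          exact (Nat.not_even_iff_odd.1 hpar).add_one)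
      refine ⟨J, hJ, fun x hx hx0 => ?_⟩
      have h1 := hJ0 x hx0
      rw [Submodule.top_orthogonal_eq_bot, Submodule.mem_bot] at h1
      simp [h1] at hx
  refine ⟨e, fun b x => if b then inner ℝ e x • (e' - inner ℝ e' x • x) else J x, he, fun b => ?_,
    fun b x => ?_, fun b x hx => ?_, fun x hx hpar h0 => ?_, fun x hx hex h0 => ?_⟩
  · cases b
    · simpa using J.continuous_of_finiteDimensional
    · simp only [if_true]
      fun_prop
  · cases b
    · simp
    · simp
  · cases b
    · simpa using hJ x
    · simp [real_inner_smul_left, inner_sub_left, hx]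
  · obtain ⟨h1, h2⟩ := hJ0 x hx (by simpa using h0)
    exact hpar h1 h2
  · simp only [if_true, smul_eq_zero, hex, false_or, sub_eq_zero] at h0
    have h1 := congrArg (inner ℝ e) h0
    rw [hee', inner_smul_right] at h1
    have h2 := (mul_eq_zero.1 h1.symm).resolve_right hex
    rw [h2, zero_smul] at h0
    simp [h0] at he'

/-- The functions on pairs of points of a sphere which separate the domains of the motion
planners. -/
def sphereCut (n : ℕ) (e : EuclideanSpace ℝ (Fin (n + 1))) :
    ℕ → Metric.sphere (0 : EuclideanSpace ℝ (Fin (n + 1))) 1 ×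
      Metric.sphere (0 : EuclideanSpace ℝ (Fin (n + 1))) 1 → ℝ
  | 0, _ => 0
  | 1, z => ‖(z.1 + z.2 : EuclideanSpace ℝ (Fin (n + 1)))‖ ^ 2 / 4
  | 2, z => if Even n then max (‖(z.1 + z.2 : EuclideanSpace ℝ (Fin (n + 1)))‖ ^ 2 / 4)
      (1 - inner ℝ e (z.1 : EuclideanSpace ℝ (Fin (n + 1))) ^ 2) else 1
  | _ + 3, _ => 1

section SpherePath

variable {V : Type*} [NormedAddCommGroup V] [InnerProductSpace ℝ V]

/-- The unnormalized motion planners on a sphere. -/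
def spherePath (v : Bool → V → V) :
    ℕ → V → V → ℝ → V
  | 0, x, y, t => (1 - t) • x + t • y
  | 1, x, y, t => rotatePath (v false x) x y t
  | _ + 2, x, y, t => rotatePath (v true x) x y t

theorem spherePath_zero (v : Bool → V → V) (j : ℕ) (x y : V) : spherePath v j x y 0 = x := by
  rcases j with _ | _ | j
  · simp [spherePath]
  all_goals exact rotatePath_zero _ _ _

theorem spherePath_one (v : Bool → V → V) (j : ℕ) (x y : V) : spherePath v j x y 1 = y := by
  rcases j with _ | _ | j
  · simp [spherePath]
  all_goals exact rotatePath_one _ _ _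

theorem spherePath_neg {v : Bool → V → V} (hv : ∀ b x, v b (-x) = -v b x) (j : ℕ) (x y : V) (t : ℝ) :
    spherePath v j (-x) (-y) t = -spherePath v j x y t := by
  rcases j with _ | _ | j
  · simp only [spherePath]
    module
  all_goals simpa [hv, spherePath] using rotatePath_smul (-1) (v _ x) x y t

theorem continuous_spherePath {v : Bool → V → V} (hv : ∀ b, Continuous (v b)) (j : ℕ) :
    Continuous fun p : (V × V) × ℝ => spherePath v j p.1.1 p.1.2 p.2 := by
  have := hv false
  have := hv true
  rcases j with _ | _ | j <;> simp only [spherePath, rotatePath] <;> fun_prop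

end SpherePath

section SphereCut

variable {n : ℕ} {e : EuclideanSpace ℝ (Fin (n + 1))}

theorem norm_add_sq_div_four_le (z : Metric.sphere (0 : EuclideanSpace ℝ (Fin (n + 1))) 1 ×
    Metric.sphere (0 : EuclideanSpace ℝ (Fin (n + 1))) 1) :
    ‖(z.1 + z.2 : EuclideanSpace ℝ (Fin (n + 1)))‖ ^ 2 / 4 ≤ 1 := by
  have h := norm_add_le (z.1 : EuclideanSpace ℝ (Fin (n + 1))) z.2
  rw [norm_eq_of_mem_sphere, norm_eq_of_mem_sphere] at h
  nlinarith [norm_nonneg (z.1 + z.2 : EuclideanSpace ℝ (Fin (n + 1)))]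

theorem ne_of_norm_add_sq_div_four_lt {z : Metric.sphere (0 : EuclideanSpace ℝ (Fin (n + 1))) 1 ×
    Metric.sphere (0 : EuclideanSpace ℝ (Fin (n + 1))) 1}
    (h : ‖(z.1 + z.2 : EuclideanSpace ℝ (Fin (n + 1)))‖ ^ 2 / 4 < 1) :
    (z.1 : EuclideanSpace ℝ (Fin (n + 1))) ≠ z.2 := by
  intro heq
  rw [← heq, ← two_smul ℝ, norm_smul, norm_eq_of_mem_sphere] at h
  norm_num at h

theorem continuous_sphereCut (j : ℕ) : Continuous (sphereCut n e j) := by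
  change Continuous fun z => sphereCut n e j z
  rcases j with _ | _ | _ | j <;> simp only [sphereCut]
  · fun_prop
  · fun_prop
  · split_ifs <;> fun_prop
  · fun_prop

theorem monotone_sphereCut (z : Metric.sphere (0 : EuclideanSpace ℝ (Fin (n + 1))) 1 ×
    Metric.sphere (0 : EuclideanSpace ℝ (Fin (n + 1))) 1) : Monotone fun j => sphereCut n e j z := by
  refine monotone_nat_of_le_succ fun j => ?_
  have h := norm_add_sq_div_four_le z
  rcases j with _ | _ | _ | j <;> simp only [sphereCut]
  · positivity
  · split_ifs
    · exact le_max_left _ _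
    · exact h
  · split_ifs
    · exact max_le h (by nlinarith [sq_nonneg (inner ℝ e (z.1 : EuclideanSpace ℝ (Fin (n + 1))))])
    · exact le_rfl
  · exact le_rfl

theorem sphereCut_smul (j : ℕ) (g : ℤˣ) (z : Metric.sphere (0 : EuclideanSpace ℝ (Fin (n + 1))) 1 ×
    Metric.sphere (0 : EuclideanSpace ℝ (Fin (n + 1))) 1) :
    sphereCut n e j (g • z) = sphereCut n e j z := by
  rcases Int.units_eq_one_or g with rfl | rfl
  · rw [one_smul]
  · have h1 : (((-1 : ℤˣ) • z).1 : EuclideanSpace ℝ (Fin (n + 1))) = -z.1 := by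
      change (((-1 : ℤˣ) : ℤ) : ℝ) • (z.1 : EuclideanSpace ℝ (Fin (n + 1))) = _
      simp
    have h2 : (((-1 : ℤˣ) • z).2 : EuclideanSpace ℝ (Fin (n + 1))) = -z.2 := by
      change (((-1 : ℤˣ) : ℤ) : ℝ) • (z.2 : EuclideanSpace ℝ (Fin (n + 1))) = _
      simp
    rcases j with _ | _ | _ | j <;>
      simp only [sphereCut, h1, h2, ← neg_add, norm_neg, inner_neg_right, neg_sq]

theorem spherePath_ne_zero
    {v : Bool → EuclideanSpace ℝ (Fin (n + 1)) → EuclideanSpace ℝ (Fin (n + 1))}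
    (htan : ∀ b x, ‖x‖ = 1 → inner ℝ (v b x) x = 0)
    (hv1 : ∀ x, ‖x‖ = 1 → (Even n → inner ℝ e x ^ 2 ≠ 1) → v false x ≠ 0)
    (hv2 : ∀ x, ‖x‖ = 1 → inner ℝ e x ≠ 0 → v true x ≠ 0) (j : ℕ) {z : Metric.sphere (0 : EuclideanSpace ℝ (Fin (n + 1))) 1 ×
    Metric.sphere (0 : EuclideanSpace ℝ (Fin (n + 1))) 1}
    (hz : sphereCut n e j z < sphereCut n e (j + 1) z) (t : I) :
    spherePath v j z.1 z.2 t ≠ 0 := by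
  have h1 : ‖(z.1 : EuclideanSpace ℝ (Fin (n + 1)))‖ = 1 := norm_eq_of_mem_sphere _
  have h2 : ‖(z.2 : EuclideanSpace ℝ (Fin (n + 1)))‖ = 1 := norm_eq_of_mem_sphere _
  have hle := norm_add_sq_div_four_le z
  rcases j with _ | _ | _ | j <;> simp only [sphereCut, spherePath] at hz ⊢
  · refine segment_ne_zero h1 h2 (fun h => ?_) t.2.1 t.2.2
    simp [h] at hz
  · have hlt : ‖(z.1 + z.2 : EuclideanSpace ℝ (Fin (n + 1)))‖ ^ 2 / 4 < 1 :=
      hz.trans_le (monotone_sphereCut (n := n) (e := e) z (show 2 ≤ 3 by norm_num))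
    refine rotatePath_ne_zero h1 h2 (hv1 _ h1 fun hpar h => ?_) (htan _ _ h1)
      (ne_of_norm_add_sq_div_four_lt hlt) t
    rw [if_pos hpar, h, sub_self, lt_max_iff] at hz
    rcases hz with hz | hz
    · exact lt_irrefl _ hz
    · exact absurd hz (not_lt.2 (by positivity))
  · split_ifs at hz with hpar
    · rw [max_lt_iff] at hz
      refine rotatePath_ne_zero h1 h2 (hv2 _ h1 fun h => ?_) (htan _ _ h1)
        (ne_of_norm_add_sq_div_four_lt hz.1) t
      simp [h] at hz
    · exact absurd hz (lt_irrefl _)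
  · exact absurd hz (lt_irrefl _)

end SphereCut

/-- The upper bound for the equivariant topological complexity of a product of spheres. -/
theorem eqTCCover_pi_sphere {r : ℕ} {n : Fin r → ℕ} (hn : ∀ i, 1 ≤ n i) :
    EqTCCover ℤˣ (Π i, Metric.sphere (0 : EuclideanSpace ℝ (Fin (n i + 1))) 1)
      (r + (Finset.univ.filter fun i => Even (n i)).card) := by
  choose e v he hvc hodd htan hv1 hv2 using fun i => exists_tangent_fields (hn i)
  have hsum : r + (Finset.univ.filter fun i => Even (n i)).card =
      ∑ i, (1 + if Even (n i) then 1 else 0) := by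
    simp [Finset.sum_add_distrib]
  rw [hsum]
  have hne := fun i j z hz t => spherePath_ne_zero (htan i) (hv1 i) (hv2 i) j (z := z) hz t
  refine EqTCCover.pi _ (fun i => sphereCut (n i) (e i)) (fun i j z t =>
    normalizeSphere ⟨e i, mem_sphere_zero_iff_norm.2 (he i)⟩ (spherePath (v i) j z.1 z.2 t))
    (fun i j => continuous_sphereCut j) (fun i z => monotone_sphereCut z)
    (fun i j g z => sphereCut_smul j g z) (fun i z => rfl) (fun i z => ?_) (fun i j => ?_)
    (fun i j z hz => ?_) (fun i j z hz => ?_) (fun i j g z t hz => ?_)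
  · split_ifs with h
    · rfl
    · simp [sphereCut, h]
  · refine (continuousOn_normalizeSphere _).comp (Continuous.continuousOn ?_)
      fun p hp => hne i j p.1 hp p.2
    exact (continuous_spherePath (hvc i) j).comp (by fun_prop : Continuous
      fun p : (Metric.sphere (0 : EuclideanSpace ℝ (Fin (n i + 1))) 1 ×
        Metric.sphere (0 : EuclideanSpace ℝ (Fin (n i + 1))) 1) × I =>
      (((p.1.1 : EuclideanSpace ℝ (Fin (n i + 1))), (p.1.2 : EuclideanSpace ℝ (Fin (n i + 1)))),
        (p.2 : ℝ)))
  · refine Subtype.ext ?_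
    rw [coe_normalizeSphere _ (hne i j z hz 0), Icc.coe_zero, spherePath_zero,
      norm_eq_of_mem_sphere, inv_one, one_smul]
  · refine Subtype.ext ?_
    rw [coe_normalizeSphere _ (hne i j z hz 1), Icc.coe_one, spherePath_one,
      norm_eq_of_mem_sphere, inv_one, one_smul]
  · rcases Int.units_eq_one_or g with rfl | rfl
    · rw [one_smul, one_smul]
    · have hneg : ∀ x : Metric.sphere (0 : EuclideanSpace ℝ (Fin (n i + 1))) 1,
          (((-1 : ℤˣ) • x : Metric.sphere (0 : EuclideanSpace ℝ (Fin (n i + 1))) 1) :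
            EuclideanSpace ℝ (Fin (n i + 1))) = -x := fun x => by
        change (((-1 : ℤˣ) : ℤ) : ℝ) • (x : EuclideanSpace ℝ (Fin (n i + 1))) = _
        simp
      have h0 := hne i j z hz t
      refine Subtype.ext ?_
      rw [hneg, Prod.smul_fst, Prod.smul_snd, hneg, hneg, spherePath_neg (hodd i),
        coe_normalizeSphere _ (neg_ne_zero.2 h0), coe_normalizeSphere _ h0, norm_neg, smul_neg]

set_option synthInstance.maxHeartbeats 1000000 in
/-- Let `G = ℤ/2` act diagonally (antipodally on each factor) on
`S_{n̄} = S^{n₁} × ⋯ × S^{n_r}`, where all `nᵢ ≥ 1`. If `k` is the number of indices `i`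
with `nᵢ` even, then the (reduced) equivariant topological complexity satisfies
`TC_G(S_{n̄}) = r + k = Σᵢ TC_G(S^{nᵢ})`. -/
theorem stmt8 (r : ℕ) (hr : 0 < r) (n : Fin r → ℕ) (hn : ∀ i, 1 ≤ n i) :
    eqTC ℤˣ (Π i, Metric.sphere (0 : EuclideanSpace ℝ (Fin (n i + 1))) 1) =
      (r : ℕ∞) + ((Finset.univ.filter fun i => Even (n i)).card : ℕ∞) := by
  rw [eqTC]
  refine le_antisymm (sInf_le ⟨_, eqTCCover_pi_sphere hn, by push_cast; rfl⟩) (le_sInf ?_)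
  rintro _ ⟨m, hm, rfl⟩
  exact_mod_cast hm.tcCover.add_card_even_le hr n

end
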